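/- arXiv:1811.00618 — 3 statements merged into one kernel-verified Lean document; each statement's English description precedes it below -/
import Mathlib

section
/- Let p₁(·), p₂(·) : ℝⁿ → [1,∞) satisfy 1 < (pⱼ)₋ ≤ (pⱼ)₊ < ∞ and pⱼ(·) ∈ LH for j = 1,2, define p(·) by 1/p = 1/p₁ + 1/p₂, let w₁, w₂ be weights with w = w₁w₂ and (w₁,w₂,w) ∈ A_{p⃗(·)}, and set u(x) = w(x)^{p(x)}, σⱼ(x) = wⱼ(x)^{−pⱼ'(x)}. For a cube Q, let q(Q) be defined by 1/q(Q) = 1/(p₁)₋(Q) + 1/(p₂)₋(Q). Then there is a constant C independent of Q such that for every cube Q and every measurable set E ⊂ Q, ∫_E σ₁(Q)^{q(Q)}σ₂(Q)^{q(Q)}|Q|^{−2p(x)}u(x) dx ≤ C·σ₁(Q)^{q(Q)/(p₁)₋(Q)}·σ₂(Q)^{q(Q)/(p₂)₋(Q)}. -/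
open MeasureTheory ENNReal Set

noncomputable section

/-- Euclidean space `ℝⁿ`. -/
abbrev Rn (n : ℕ) : Type := Fin n → ℝ

/-- A cube in `ℝⁿ` with sides parallel to the coordinate axes. -/
structure Cube (n : ℕ) : Type where
  base : Fin n → ℝ
  side : ℝ
  side_pos : 0 < side

namespace Cube

/-- The set of points of a cube. -/
def toSet {n : ℕ} (Q : Cube n) : Set (Rn n) :=
  {x | ∀ i, Q.base i ≤ x i ∧ x i < Q.base i + Q.side}

/-- The volume `|Q|` of a cube. -/
def vol {n : ℕ} (Q : Cube n) : ℝ≥0∞ := ENNReal.ofReal (Q.side ^ n)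

/-- Membership in the standard dyadic grid `𝒟₀`. -/
def IsDyadic {n : ℕ} (Q : Cube n) : Prop :=
  ∃ (k : ℤ) (j : Fin n → ℤ), Q.side = (2 : ℝ) ^ (-k) ∧
    ∀ i, Q.base i = (2 : ℝ) ^ (-k) * (j i : ℝ)

end Cube

/-- The modular associated to an extended-real-valued exponent `r(·)`:
`ρ(f/λ) = ∫_{r ≠ ∞} (f/λ)^{r(x)} dμ + ‖f/λ‖_{L^∞({r = ∞})}`. -/
def eModular {n : ℕ} (r : Rn n → ℝ≥0∞) (μ : Measure (Rn n)) (f : Rn n → ℝ≥0∞)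
    (lam : ℝ≥0∞) : ℝ≥0∞ :=
  (∫⁻ x in {x | r x ≠ ∞}, (f x / lam) ^ (r x).toReal ∂μ)
    + essSup (fun x => f x / lam) (μ.restrict {x | r x = ∞})

/-- The variable Lebesgue (quasi)norm `‖f‖_{r(·)}` with respect to a measure `μ`. -/
def eNorm {n : ℕ} (r : Rn n → ℝ≥0∞) (μ : Measure (Rn n)) (f : Rn n → ℝ≥0∞) : ℝ≥0∞ :=
  sInf {lam : ℝ≥0∞ | lam ≠ 0 ∧ eModular r μ f lam ≤ 1}

/-- The variable Lebesgue norm of a real-valued function with respect to Lebesgue measure. -/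
def vNorm {n : ℕ} (r : Rn n → ℝ≥0∞) (f : Rn n → ℝ) : ℝ≥0∞ :=
  eNorm r volume fun x => ENNReal.ofReal |f x|

/-- View a real-valued exponent as an extended-real-valued one. -/
def ofExp {n : ℕ} (p : Rn n → ℝ) : Rn n → ℝ≥0∞ := fun x => ENNReal.ofReal (p x)

/-- The conjugate of an extended real exponent: `1/t + 1/t' = 1`. -/
def econj (t : ℝ≥0∞) : ℝ≥0∞ :=
  if t = 1 then ∞ else if t = ∞ then 1 else ENNReal.ofReal (t.toReal / (t.toReal - 1))

/-- The pointwise conjugate exponent `p'(·)` of a real-valued exponent. -/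
def conjExp {n : ℕ} (p : Rn n → ℝ) : Rn n → ℝ≥0∞ := fun x => econj (ENNReal.ofReal (p x))

/-- A weight: a measurable function that is positive (and finite) a.e. -/
def IsWeight {n : ℕ} (w : Rn n → ℝ) : Prop :=
  Measurable w ∧ ∀ᵐ x ∂(volume : Measure (Rn n)), 0 < w x

/-- Local log-Hölder continuity `LH₀`. -/
def LH0 {n : ℕ} (p : Rn n → ℝ) : Prop :=
  ∃ C₀ > 0, ∀ x y : Rn n, dist x y < 1 / 2 →
    |1 / p x - 1 / p y| ≤ C₀ / (-Real.log (dist x y))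

/-- Log-Hölder continuity at infinity with a given asymptotic value `pinf`. -/
def LHinfWith {n : ℕ} (p : Rn n → ℝ) (pinf : ℝ) : Prop :=
  ∃ C > 0, ∀ x : Rn n, |1 / p x - 1 / pinf| ≤ C / Real.log (Real.exp 1 + ‖x‖)

/-- Log-Hölder continuity at infinity `LH∞`. -/
def LHinf {n : ℕ} (p : Rn n → ℝ) : Prop := ∃ pinf > 0, LHinfWith p pinf

/-- Log-Hölder continuity `LH = LH₀ ∩ LH∞`. -/
def LH {n : ℕ} (p : Rn n → ℝ) : Prop := LH0 p ∧ LHinf p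

/-- The bilinear variable Muckenhoupt condition `(w₁,w₂,w) ∈ A_{p⃗(·)}`. -/
def ApVec {n : ℕ} (p₁ p₂ p w₁ w₂ w : Rn n → ℝ) : Prop :=
  ∃ C : ℝ≥0∞, C ≠ ∞ ∧ ∀ Q : Cube n,
    Q.vol⁻¹ ^ 2 * vNorm (ofExp p) (Q.toSet.indicator w) *
      vNorm (conjExp p₁) (Q.toSet.indicator fun x => (w₁ x)⁻¹) *
      vNorm (conjExp p₂) (Q.toSet.indicator fun x => (w₂ x)⁻¹) ≤ C

/-- The variable Muckenhoupt class `A_{r(·)}` for an extended-real-valued exponent. -/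
def ApVarE {n : ℕ} (r : Rn n → ℝ≥0∞) (v : Rn n → ℝ) : Prop :=
  ∃ C : ℝ≥0∞, C ≠ ∞ ∧ ∀ Q : Cube n,
    Q.vol⁻¹ * vNorm r (Q.toSet.indicator v) *
      vNorm (fun x => econj (r x)) (Q.toSet.indicator fun x => (v x)⁻¹) ≤ C

/-- The bilinear maximal operator `M(f₁,f₂)`. -/
def biMax {n : ℕ} (f₁ f₂ : Rn n → ℝ) (x : Rn n) : ℝ≥0∞ :=
  ⨆ (Q : Cube n) (_ : x ∈ Q.toSet),
    (Q.vol⁻¹ * ∫⁻ y in Q.toSet, ENNReal.ofReal |f₁ y|) *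
      (Q.vol⁻¹ * ∫⁻ y in Q.toSet, ENNReal.ofReal |f₂ y|)

/-- The dyadic bilinear maximal operator `M^d(f₁,f₂)`. -/
def biMaxD {n : ℕ} (f₁ f₂ : Rn n → ℝ) (x : Rn n) : ℝ≥0∞ :=
  ⨆ (Q : Cube n) (_ : Q.IsDyadic) (_ : x ∈ Q.toSet),
    (Q.vol⁻¹ * ∫⁻ y in Q.toSet, ENNReal.ofReal |f₁ y|) *
      (Q.vol⁻¹ * ∫⁻ y in Q.toSet, ENNReal.ofReal |f₂ y|)

/-- The bilinear averaging operator `A_Q(f₁,f₂) = (⨍_Q f₁)(⨍_Q f₂)χ_Q`. -/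
def avgOp {n : ℕ} (Q : Cube n) (f₁ f₂ : Rn n → ℝ) (x : Rn n) : ℝ≥0∞ :=
  Q.toSet.indicator
    (fun _ =>
      (Q.vol⁻¹ * ∫⁻ y in Q.toSet, ENNReal.ofReal |f₁ y|) *
        (Q.vol⁻¹ * ∫⁻ y in Q.toSet, ENNReal.ofReal |f₂ y|)) x

/-- `(p)₋(Q)`, the essential infimum of `p` on a cube `Q`. -/
def pMinusOn {n : ℕ} (p : Rn n → ℝ) (Q : Cube n) : ℝ :=
  essInf p (volume.restrict Q.toSet)

/-- The exponent `q(Q)` with `1/q(Q) = 1/(p₁)₋(Q) + 1/(p₂)₋(Q)`. -/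
def qExp {n : ℕ} (p₁ p₂ : Rn n → ℝ) (Q : Cube n) : ℝ :=
  ((pMinusOn p₁ Q)⁻¹ + (pMinusOn p₂ Q)⁻¹)⁻¹

namespace Cube

lemma toSet_eq {n : ℕ} (Q : Cube n) :
    Q.toSet = Set.pi univ fun i => Ico (Q.base i) (Q.base i + Q.side) := by
  ext x
  simp [toSet, Set.mem_pi]

lemma measurableSet_toSet {n : ℕ} (Q : Cube n) : MeasurableSet Q.toSet := by
  rw [toSet_eq]
  exact MeasurableSet.univ_pi fun i => measurableSet_Ico

lemma volume_toSet {n : ℕ} (Q : Cube n) : volume Q.toSet = ENNReal.ofReal (Q.side ^ n) := by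
  rw [toSet_eq, Real.volume_pi_Ico]
  simp [ENNReal.ofReal_pow Q.side_pos.le]

lemma dist_le_side {n : ℕ} (Q : Cube n) {x y : Rn n} (hx : x ∈ Q.toSet) (hy : y ∈ Q.toSet) :
    dist x y ≤ Q.side := by
  refine (dist_pi_le_iff Q.side_pos.le).2 fun i => ?_
  rw [Real.dist_eq, abs_le]
  have h1 := hx i
  have h2 := hy i
  constructor <;> linarith

lemma ae_restrict_neBot {n : ℕ} (Q : Cube n) : (ae (volume.restrict Q.toSet)).NeBot := by
  rw [ae_neBot, Ne, Measure.restrict_eq_zero, volume_toSet]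
  simpa using pow_pos Q.side_pos n

end Cube

/-- `t` is an admissible positive number in the definition of the norm `‖f χ_Q‖_{r(·)}`. -/
def IsAdmissible {n : ℕ} (r f : Rn n → ℝ) (Q : Cube n) (t : ℝ) : Prop :=
  0 < t ∧ ∫⁻ x in Q.toSet, ENNReal.ofReal ((f x / t) ^ r x) ≤ 1

lemma IsAdmissible.mono {n : ℕ} {r f : Rn n → ℝ} {Q Q' : Cube n} {t : ℝ}
    (h : IsAdmissible r f Q' t) (hQ : Q.toSet ⊆ Q'.toSet) : IsAdmissible r f Q t :=
  ⟨h.1, (lintegral_mono_set hQ).trans h.2⟩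

/-- Three a.e. positive functions with product `1` whose exponents satisfy
`1/r₁ + 1/r₂ + 1/r₃ = 2`. -/
structure DualTriple {n : ℕ} (r₁ r₂ r₃ f₁ f₂ f₃ : Rn n → ℝ) : Prop where
  meas_r₁ : Measurable r₁
  meas_r₂ : Measurable r₂
  meas_r₃ : Measurable r₃
  meas_f₁ : Measurable f₁
  meas_f₂ : Measurable f₂
  meas_f₃ : Measurable f₃
  ae_pos : ∀ᵐ x ∂(volume : Measure (Rn n)), 0 < f₁ x ∧ 0 < f₂ x ∧ 0 < f₃ x
  ae_prod : ∀ᵐ x ∂(volume : Measure (Rn n)), f₁ x * f₂ x * f₃ x = 1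
  ae_exp_pos : ∀ᵐ x ∂(volume : Measure (Rn n)), 0 < r₁ x ∧ 0 < r₂ x ∧ 0 < r₃ x
  ae_exp : ∀ᵐ x ∂(volume : Measure (Rn n)), 1 / r₁ x + 1 / r₂ x + 1 / r₃ x = 2

lemma DualTriple.rotate {n : ℕ} {r₁ r₂ r₃ f₁ f₂ f₃ : Rn n → ℝ}
    (h : DualTriple r₁ r₂ r₃ f₁ f₂ f₃) : DualTriple r₂ r₃ r₁ f₂ f₃ f₁ where
  meas_r₁ := h.meas_r₂
  meas_r₂ := h.meas_r₃
  meas_r₃ := h.meas_r₁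
  meas_f₁ := h.meas_f₂
  meas_f₂ := h.meas_f₃
  meas_f₃ := h.meas_f₁
  ae_pos := h.ae_pos.mono fun _ hx => ⟨hx.2.1, hx.2.2, hx.1⟩
  ae_prod := h.ae_prod.mono fun _ hx => by rw [← hx]; ring
  ae_exp_pos := h.ae_exp_pos.mono fun _ hx => ⟨hx.2.1, hx.2.2, hx.1⟩
  ae_exp := h.ae_exp.mono fun _ hx => by rw [← hx]; ring

/-- The geometric mean `√(abc)` is dominated by `a^r + b^s + c^t` when `1/r + 1/s + 1/t = 2`. -/
lemma sqrt_mul_le_add_rpow {a b c r s t : ℝ} (ha : 0 < a) (hb : 0 < b) (hc : 0 < c)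
    (hr : 0 < r) (hs : 0 < s) (ht : 0 < t) (h : 1 / r + 1 / s + 1 / t = 2) :
    (a * b * c) ^ (1 / 2 : ℝ) ≤ a ^ r + b ^ s + c ^ t := by
  have h1 := Real.geom_mean_le_arith_mean3_weighted (w₁ := 1 / (2 * r)) (w₂ := 1 / (2 * s))
    (w₃ := 1 / (2 * t)) (by positivity) (by positivity) (by positivity)
    (Real.rpow_nonneg ha.le r) (Real.rpow_nonneg hb.le s) (Real.rpow_nonneg hc.le t)
    (by rw [show 1 / (2 * r) + 1 / (2 * s) + 1 / (2 * t) = (1 / r + 1 / s + 1 / t) / 2 by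
          field_simp, h]; norm_num)
  rw [← Real.rpow_mul ha.le, ← Real.rpow_mul hb.le, ← Real.rpow_mul hc.le,
    show r * (1 / (2 * r)) = 1 / 2 by field_simp, show s * (1 / (2 * s)) = 1 / 2 by field_simp,
    show t * (1 / (2 * t)) = 1 / 2 by field_simp, ← Real.mul_rpow ha.le hb.le,
    ← Real.mul_rpow (by positivity) hc.le] at h1
  have key : ∀ z : ℝ, 0 < z → 1 / z ≤ 2 → 1 / (2 * z) ≤ 1 := by
    intro z hz h
    rw [show 1 / (2 * z) = (1 / z) / 2 by field_simp]
    linarith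
  have pr : 0 < 1 / r := by positivity
  have ps : 0 < 1 / s := by positivity
  have pt : 0 < 1 / t := by positivity
  have e1 := mul_le_mul_of_nonneg_right (key r hr (by linarith)) (Real.rpow_nonneg ha.le r)
  have e2 := mul_le_mul_of_nonneg_right (key s hs (by linarith)) (Real.rpow_nonneg hb.le s)
  have e3 := mul_le_mul_of_nonneg_right (key t ht (by linarith)) (Real.rpow_nonneg hc.le t)
  linarith

/-- The trilinear Hölder inequality on a cube. -/
lemma DualTriple.sq_vol_le {n : ℕ} {r₁ r₂ r₃ f₁ f₂ f₃ : Rn n → ℝ}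
    (h : DualTriple r₁ r₂ r₃ f₁ f₂ f₃) {Q : Cube n} {t₁ t₂ t₃ : ℝ}
    (h₁ : IsAdmissible r₁ f₁ Q t₁) (h₂ : IsAdmissible r₂ f₂ Q t₂)
    (h₃ : IsAdmissible r₃ f₃ Q t₃) :
    (Q.side ^ n) ^ 2 ≤ 9 * (t₁ * t₂ * t₃) := by
  obtain ⟨p₁, i₁⟩ := h₁
  obtain ⟨p₂, i₂⟩ := h₂
  obtain ⟨p₃, i₃⟩ := h₃
  have hT : 0 < t₁ * t₂ * t₃ := by positivity
  have hs : 0 < Q.side ^ n := pow_pos Q.side_pos n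
  have m₁ : Measurable fun x => ENNReal.ofReal ((f₁ x / t₁) ^ r₁ x) :=
    ((h.meas_f₁.div_const _).pow h.meas_r₁).ennreal_ofReal
  have m₂ : Measurable fun x => ENNReal.ofReal ((f₂ x / t₂) ^ r₂ x) :=
    ((h.meas_f₂.div_const _).pow h.meas_r₂).ennreal_ofReal
  have key : ∫⁻ _ in Q.toSet, ENNReal.ofReal ((1 / (t₁ * t₂ * t₃)) ^ (1 / 2 : ℝ)) ≤ 3 := by
    calc _ ≤ ∫⁻ x in Q.toSet, (ENNReal.ofReal ((f₁ x / t₁) ^ r₁ x) +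
            (ENNReal.ofReal ((f₂ x / t₂) ^ r₂ x) + ENNReal.ofReal ((f₃ x / t₃) ^ r₃ x))) := by
          refine lintegral_mono_ae (ae_restrict_of_ae ?_)
          filter_upwards [h.ae_pos, h.ae_prod, h.ae_exp_pos, h.ae_exp] with x hx hp hr he
          obtain ⟨a1, a2, a3⟩ := hx
          obtain ⟨b1, b2, b3⟩ := hr
          rw [← ENNReal.ofReal_add (by positivity) (by positivity),
            ← ENNReal.ofReal_add (by positivity) (by positivity)]
          refine ENNReal.ofReal_le_ofReal ?_
          rw [← add_assoc, show 1 / (t₁ * t₂ * t₃)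
            = f₁ x / t₁ * (f₂ x / t₂) * (f₃ x / t₃) by field_simp; exact hp.symm]
          exact sqrt_mul_le_add_rpow (by positivity) (by positivity) (by positivity) b1 b2 b3 he
      _ ≤ 1 + (1 + 1) := by
          rw [lintegral_add_left m₁, lintegral_add_left m₂]
          gcongr
      _ = 3 := by norm_num
  rw [setLIntegral_const, Q.volume_toSet, ← ENNReal.ofReal_mul (by positivity),
    show (3 : ℝ≥0∞) = ENNReal.ofReal 3 by simp, ENNReal.ofReal_le_ofReal_iff (by norm_num),
    Real.div_rpow zero_le_one hT.le, Real.one_rpow, ← Real.sqrt_eq_rpow,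
    div_mul_eq_mul_div, div_le_iff₀ (Real.sqrt_pos.2 hT), one_mul] at key
  calc (Q.side ^ n) ^ 2 ≤ (3 * √(t₁ * t₂ * t₃)) ^ 2 := by gcongr
    _ = 9 * (t₁ * t₂ * t₃) := by rw [mul_pow, Real.sq_sqrt hT.le]; norm_num

/-- A quantitative lower bound for admissible numbers, as a consequence of the Muckenhoupt
condition on large cubes. -/
lemma DualTriple.exists_lower_bound {n : ℕ} {r₁ r₂ r₃ f₁ f₂ f₃ : Rn n → ℝ}
    (h : DualTriple r₁ r₂ r₃ f₁ f₂ f₃) {A : ℝ}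
    (hA : ∀ Q : Cube n, ∃ t₁ t₂ t₃, IsAdmissible r₁ f₁ Q t₁ ∧ IsAdmissible r₂ f₂ Q t₂ ∧
      IsAdmissible r₃ f₃ Q t₃ ∧ t₁ * t₂ * t₃ ≤ A * (Q.side ^ n) ^ 2) :
    ∃ c > 0, ∀ (Q : Cube n) (t : ℝ), IsAdmissible r₁ f₁ Q t → ∀ x ∈ Q.toSet,
      c * (Q.side / (‖x‖ + Q.side + 1)) ^ (n * 2) ≤ t := by
  let U : Cube n := ⟨fun _ => 0, 1, one_pos⟩
  obtain ⟨u₁, u₂, u₃, -, hu₂, hu₃, hU⟩ := hA U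
  have hu₂' := hu₂.1
  have hu₃' := hu₃.1
  have hA0 : 0 < A := by
    obtain ⟨s₁, s₂, s₃, g₁, g₂, g₃, hs⟩ := hA U
    have : 0 < s₁ * s₂ * s₃ := mul_pos (mul_pos g₁.1 g₂.1) g₃.1
    have h2 : 0 < A * (U.side ^ n) ^ 2 := this.trans_le hs
    exact pos_of_mul_pos_left h2 (by positivity)
  refine ⟨1 / (81 * A * (u₂ * u₃) * 2 ^ (n * 2)), by positivity, fun Q t ht x hx => ?_⟩
  have hside := Q.side_pos
  set M : ℝ := ‖x‖ + Q.side + 1 with hM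
  have hM0 : 0 < M := by positivity
  let Q₀ : Cube n := ⟨fun _ => -M, 2 * M, by positivity⟩
  have hQ : Q.toSet ⊆ Q₀.toSet := by
    intro y hy i
    have h1 := Q.dist_le_side hy hx
    have h2 := (dist_le_pi_dist y x i).trans h1
    have h3 := norm_le_pi_norm x i
    rw [Real.dist_eq, abs_le] at h2
    rw [Real.norm_eq_abs, abs_le] at h3
    simp only [Q₀]
    constructor <;> linarith
  have hUQ : U.toSet ⊆ Q₀.toSet := by
    intro y hy i
    have h1 := hy i
    have h2 := norm_nonneg x
    simp only [U, Q₀] at h1 ⊢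
    constructor <;> linarith
  obtain ⟨s₁, s₂, s₃, g₁, g₂, g₃, hs⟩ := hA Q₀
  have e1 := h.sq_vol_le ht (g₂.mono hQ) (g₃.mono hQ)
  have e2 := h.sq_vol_le (g₁.mono hUQ) hu₂ hu₃
  have hg₁ := g₁.1
  have hg₂ := g₂.1
  have hg₃ := g₃.1
  have ht0 := ht.1
  simp only [U, one_pow] at e2
  have e3 : (Q.side ^ n) ^ 2 ≤ 81 * A * (u₂ * u₃) * ((2 * M) ^ n) ^ 2 * t := by
    calc (Q.side ^ n) ^ 2 ≤ 9 * (t * s₂ * s₃) * 1 := by linarith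
      _ ≤ 9 * (t * s₂ * s₃) * (9 * (s₁ * u₂ * u₃)) := by gcongr
      _ = 81 * (u₂ * u₃) * t * (s₁ * s₂ * s₃) := by ring
      _ ≤ 81 * (u₂ * u₃) * t * (A * ((2 * M) ^ n) ^ 2) := by gcongr
      _ = _ := by ring
  rw [div_pow, one_div_mul_eq_div, div_div, div_le_iff₀ (by positivity)]
  calc Q.side ^ (n * 2) = (Q.side ^ n) ^ 2 := by rw [pow_mul]
    _ ≤ _ := e3
    _ = _ := by rw [← pow_mul, mul_pow]; ring

lemma LH0.sub_mul_log_le {n : ℕ} {r : Rn n → ℝ} (h : LH0 r) (hr : ∀ x, 1 ≤ r x) :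
    ∃ K ≥ 0, ∀ (x y : Rn n) (l : ℝ), 0 < l → dist x y ≤ l →
      |1 / r y - 1 / r x| * Real.log (1 + 1 / l) ≤ K := by
  obtain ⟨C₀, hC₀, h⟩ := h
  refine ⟨2 * C₀ + Real.log 5, by positivity, fun x y l hl hd => ?_⟩
  have hlog5 : 0 ≤ Real.log 5 := by positivity
  by_cases hl4 : 1 / 4 ≤ l
  · have h1 : |1 / r y - 1 / r x| ≤ 1 := by
      have hy := hr y
      have hx := hr x
      have a1 : 0 < 1 / r y := by positivity
      have a2 : 0 < 1 / r x := by positivity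
      have a3 : 1 / r y ≤ 1 := by rw [div_le_one (by linarith)]; exact hy
      have a4 : 1 / r x ≤ 1 := by rw [div_le_one (by linarith)]; exact hx
      rw [abs_le]
      constructor <;> linarith
    have h2 : 1 / l ≤ 4 := by
      rw [div_le_iff₀ hl]
      linarith
    have h3 : Real.log (1 + 1 / l) ≤ Real.log 5 :=
      Real.log_le_log (by positivity) (by linarith)
    calc _ ≤ 1 * Real.log 5 := mul_le_mul h1 h3 (Real.log_nonneg (by
          have : 0 < 1 / l := by positivity
          linarith)) zero_le_one
      _ ≤ _ := by linarith
  · push Not at hl4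
    rcases (dist_nonneg (x := x) (y := y)).eq_or_lt with h0 | h0
    · rw [dist_eq_zero.1 h0.symm]
      simp only [sub_self, abs_zero, zero_mul]
      linarith
    · have h1 := h x y (by linarith)
      have h2 : Real.log (dist x y) ≤ Real.log l := Real.log_le_log h0 hd
      have h3 : Real.log l < 0 := Real.log_neg hl (by linarith)
      have h4 : Real.log (1 + 1 / l) ≤ 2 * (-Real.log l) := by
        rw [show 2 * (-Real.log l) = Real.log ((1 / l) ^ 2) by
          rw [Real.log_pow, one_div, Real.log_inv]; norm_num]
        refine Real.log_le_log (by positivity) ?_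
        have : 4 ≤ 1 / l := by
          rw [le_div_iff₀ hl]
          linarith
        nlinarith
      have h5 : |1 / r y - 1 / r x| ≤ C₀ / (-Real.log l) := by
        rw [abs_sub_comm]
        refine h1.trans ?_
        gcongr
        linarith
      calc _ ≤ C₀ / (-Real.log l) * (2 * (-Real.log l)) := by
            refine mul_le_mul h5 h4 (Real.log_nonneg ?_) (div_nonneg hC₀.le (by linarith))
            have : 0 < 1 / l := by positivity
            linarith
        _ = 2 * C₀ := by
            have : -Real.log l ≠ 0 := by linarith
            rw [mul_comm 2, ← mul_assoc, div_mul_cancel₀ _ this, mul_comm]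
        _ ≤ _ := by linarith

lemma LHinf.sub_mul_log_le {n : ℕ} {r : Rn n → ℝ} (h : LHinf r) :
    ∃ K ≥ 0, ∀ (x y : Rn n), ‖x‖ ≤ ‖y‖ →
      |1 / r y - 1 / r x| * Real.log (Real.exp 1 + ‖x‖) ≤ K := by
  obtain ⟨pinf, -, C, hC, h⟩ := h
  refine ⟨2 * C, by positivity, fun x y hxy => ?_⟩
  have he : 1 ≤ Real.exp 1 := Real.one_le_exp zero_le_one
  have hx : 0 < Real.log (Real.exp 1 + ‖x‖) := by
    refine Real.log_pos ?_
    have := Real.add_one_lt_exp (one_ne_zero)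
    have := norm_nonneg x
    linarith
  have h2 : Real.log (Real.exp 1 + ‖x‖) ≤ Real.log (Real.exp 1 + ‖y‖) :=
    Real.log_le_log (by positivity) (by linarith)
  have h3 : |1 / r y - 1 / r x| ≤ 2 * C / Real.log (Real.exp 1 + ‖x‖) := by
    calc |1 / r y - 1 / r x| = |(1 / r y - 1 / pinf) - (1 / r x - 1 / pinf)| := by
          congr 1
          ring
      _ ≤ |1 / r y - 1 / pinf| + |1 / r x - 1 / pinf| := abs_sub _ _
      _ ≤ C / Real.log (Real.exp 1 + ‖x‖) + C / Real.log (Real.exp 1 + ‖x‖) := by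
          refine add_le_add ((h y).trans ?_) (h x)
          gcongr
      _ = _ := by ring
  calc _ ≤ 2 * C / Real.log (Real.exp 1 + ‖x‖) * Real.log (Real.exp 1 + ‖x‖) := by gcongr
    _ = 2 * C := by field_simp

/-- Log-Hölder continuity makes the oscillation of `1 / r` on a cube `Q` harmless against numbers
bounded below by a power of `ℓ(Q) / (‖x‖ + ℓ(Q) + 1)`. -/
lemma LH.sub_mul_neg_log_le {n : ℕ} {r : Rn n → ℝ} (h : LH r) (hr : ∀ x, 1 ≤ r x) {c : ℝ}
    (hc : 0 < c) (m : ℕ) :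
    ∃ K ≥ 0, ∀ (Q : Cube n) (t : ℝ),
      (∀ x ∈ Q.toSet, c * (Q.side / (‖x‖ + Q.side + 1)) ^ m ≤ t) →
      ∀ x ∈ Q.toSet, ∀ y ∈ Q.toSet, |1 / r y - 1 / r x| * (-Real.log t) ≤ K := by
  obtain ⟨K₁, hK₁, h₁⟩ := h.1.sub_mul_log_le hr
  obtain ⟨K₂, hK₂, h₂⟩ := h.2.sub_mul_log_le
  refine ⟨|Real.log c| + m * (K₁ + K₂), by positivity, fun Q t ht x hx y hy => ?_⟩
  wlog hxy : ‖x‖ ≤ ‖y‖ generalizing x y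
  · rw [abs_sub_comm]
    exact this y hy x hx (le_of_not_ge hxy)
  have hl := Q.side_pos
  have ha := h₁ x y Q.side hl (Q.dist_le_side hx hy)
  have hb := h₂ x y hxy
  have hδ : |1 / r y - 1 / r x| ≤ 1 := by
    have hy := hr y
    have hx := hr x
    have a1 : 0 < 1 / r y := by positivity
    have a2 : 0 < 1 / r x := by positivity
    have a3 : 1 / r y ≤ 1 := by rw [div_le_one (by linarith)]; exact hy
    have a4 : 1 / r x ≤ 1 := by rw [div_le_one (by linarith)]; exact hx
    rw [abs_le]
    constructor <;> linarith
  set δ := |1 / r y - 1 / r x|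
  have hδ0 : 0 ≤ δ := abs_nonneg _
  have hM : 0 < ‖x‖ + Q.side + 1 := by positivity
  have h3 : Real.log c + m * (Real.log (Q.side / (‖x‖ + Q.side + 1))) ≤ Real.log t := by
    rw [← Real.log_pow, ← Real.log_mul hc.ne' (by positivity)]
    exact Real.log_le_log (by positivity) (ht x hx)
  have he : 1 ≤ Real.exp 1 := Real.one_le_exp zero_le_one
  have h4 : -Real.log (Q.side / (‖x‖ + Q.side + 1)) ≤
      Real.log (1 + 1 / Q.side) + Real.log (Real.exp 1 + ‖x‖) := by
    rw [← Real.log_inv, ← Real.log_mul (by positivity) (by positivity), inv_div]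
    refine Real.log_le_log (by positivity) ?_
    rw [div_le_iff₀ hl]
    have : (1 + 1 / Q.side) * (Real.exp 1 + ‖x‖) * Q.side =
      (Q.side + 1) * (Real.exp 1 + ‖x‖) := by field_simp
    rw [this]
    nlinarith [norm_nonneg x, mul_nonneg hl.le (norm_nonneg x)]
  have h5 : -Real.log t ≤ |Real.log c| +
      m * (Real.log (1 + 1 / Q.side) + Real.log (Real.exp 1 + ‖x‖)) := by
    have := mul_le_mul_of_nonneg_left h4 (Nat.cast_nonneg (α := ℝ) m)
    have := neg_abs_le (Real.log c)
    linarith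
  calc δ * (-Real.log t) ≤ δ * (|Real.log c| +
      m * (Real.log (1 + 1 / Q.side) + Real.log (Real.exp 1 + ‖x‖))) := by gcongr
    _ = δ * |Real.log c| + m * (δ * Real.log (1 + 1 / Q.side) +
          δ * Real.log (Real.exp 1 + ‖x‖)) := by ring
    _ ≤ 1 * |Real.log c| + m * (K₁ + K₂) := by gcongr
    _ = _ := by rw [one_mul]

lemma pMinusOn_le_ae {n : ℕ} {r : Rn n → ℝ} (hr : ∀ x, 1 ≤ r x) (Q : Cube n) :
    ∀ᵐ x ∂(volume.restrict Q.toSet), pMinusOn r Q ≤ r x :=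
  ae_essInf_le ⟨1, Filter.eventually_map.2 (Filter.Eventually.of_forall hr)⟩

lemma le_pMinusOn {n : ℕ} {r : Rn n → ℝ} {b c : ℝ} (Q : Cube n)
    (hb : ∀ᵐ x ∂(volume.restrict Q.toSet), r x ≤ b)
    (hc : ∀ᵐ x ∂(volume.restrict Q.toSet), c ≤ r x) : c ≤ pMinusOn r Q := by
  have := Q.ae_restrict_neBot
  exact le_essInf_of_ae_le c hc
    (Filter.IsBoundedUnder.isCoboundedUnder_ge ⟨b, Filter.eventually_map.2 hb⟩)

/-- A pointwise oscillation bound for `1 / r` on `Q` passes to `(r)₋(Q)`. -/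
lemma inv_pMinusOn_sub_mul_le {n : ℕ} {r : Rn n → ℝ} (hr : ∀ x, 1 ≤ r x) {b : ℝ} {Q : Cube n}
    (hb : ∀ᵐ x ∂(volume.restrict Q.toSet), r x ≤ b) {K L : ℝ} (hK : 0 ≤ K)
    (h : ∀ x ∈ Q.toSet, ∀ y ∈ Q.toSet, |1 / r y - 1 / r x| * L ≤ K) :
    ∀ᵐ x ∂(volume.restrict Q.toSet), (1 / pMinusOn r Q - 1 / r x) * L ≤ K := by
  have h1 : 1 ≤ pMinusOn r Q := le_pMinusOn Q hb (Filter.Eventually.of_forall hr)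
  filter_upwards [pMinusOn_le_ae hr Q, ae_restrict_mem Q.measurableSet_toSet] with x hx hxQ
  have hδ : 0 ≤ 1 / pMinusOn r Q - 1 / r x :=
    sub_nonneg.2 (one_div_le_one_div_of_le (by linarith) hx)
  rcases le_or_gt L 0 with hL | hL
  · exact (mul_nonpos_of_nonneg_of_nonpos hδ hL).trans hK
  · have hrx := hr x
    have hg : 0 < 1 / r x + K / L := by positivity
    rw [← le_div_iff₀ hL, sub_le_iff_le_add, add_comm,
      one_div_le (by linarith) hg]
    refine le_pMinusOn Q hb ?_
    filter_upwards [ae_restrict_mem Q.measurableSet_toSet] with y hy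
    have hry := hr y
    rw [one_div_le hg (by linarith)]
    have h2 := h x hxQ y hy
    rw [← le_div_iff₀ hL] at h2
    linarith [le_abs_self (1 / r y - 1 / r x)]

lemma isAdmissible_toReal {n : ℕ} {r : Rn n → ℝ≥0∞} {s f : Rn n → ℝ} {Q : Cube n}
    (hs : ∀ᵐ x ∂(volume : Measure (Rn n)), r x = ENNReal.ofReal (s x) ∧ 1 / 2 ≤ s x)
    (hf : ∀ᵐ x ∂(volume : Measure (Rn n)), 0 < f x) {lam : ℝ≥0∞} (h0 : lam ≠ 0) (ht : lam ≠ ∞)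
    (h : eModular r volume (fun x => ENNReal.ofReal |Q.toSet.indicator f x|) lam ≤ 1) :
    IsAdmissible s f Q lam.toReal := by
  have hpos : 0 < lam.toReal := ENNReal.toReal_pos h0 ht
  refine ⟨hpos, le_trans ?_ (le_self_add.trans h)⟩
  rw [Measure.restrict_eq_self_of_ae_mem (s := {x | r x ≠ ∞})
    (hs.mono fun x hx => by simp [hx.1])]
  refine le_trans ?_ (setLIntegral_le_lintegral Q.toSet _)
  refine lintegral_mono_ae ?_
  filter_upwards [ae_restrict_of_ae hs, ae_restrict_of_ae hf,
    ae_restrict_mem Q.measurableSet_toSet] with x hx hfx hxQ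
  have hsx : 0 ≤ s x := by linarith [hx.2]
  rw [hx.1, ENNReal.toReal_ofReal hsx, indicator_of_mem hxQ, abs_of_pos hfx,
    ← ENNReal.ofReal_rpow_of_nonneg (by positivity) hsx, ENNReal.ofReal_div_of_pos hpos,
    ENNReal.ofReal_toReal ht]

lemma vNorm_indicator_ne_zero {n : ℕ} {r : Rn n → ℝ≥0∞} {s f : Rn n → ℝ} (Q : Cube n)
    (hsm : Measurable s) (hfm : Measurable f)
    (hs : ∀ᵐ x ∂(volume : Measure (Rn n)), r x = ENNReal.ofReal (s x) ∧ 1 / 2 ≤ s x)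
    (hf : ∀ᵐ x ∂(volume : Measure (Rn n)), 0 < f x) :
    vNorm r (Q.toSet.indicator f) ≠ 0 := by
  intro h0
  set I := ∫⁻ x in Q.toSet, ENNReal.ofReal (f x ^ s x) with hI
  have hmeas : Measurable fun x => ENNReal.ofReal (f x ^ s x) := (hfm.pow hsm).ennreal_ofReal
  have hI0 : I ≠ 0 := by
    intro h
    rw [hI, lintegral_eq_zero_iff hmeas] at h
    have := Q.ae_restrict_neBot
    obtain ⟨x, hx, hx'⟩ := (h.and (ae_restrict_of_ae hf)).exists
    simp only [Pi.zero_apply, ENNReal.ofReal_eq_zero] at hx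
    exact absurd (Real.rpow_pos_of_pos hx' (s x)) hx.not_gt
  obtain ⟨z, hz0, hz⟩ := exists_between (lt_min (pos_iff_ne_zero.2 hI0) (zero_lt_one' ℝ≥0∞))
  have hz1 : z < 1 := hz.trans_le (min_le_right _ _)
  have hzI : z < I := hz.trans_le (min_le_left _ _)
  have hlt : vNorm r (Q.toSet.indicator f) < z ^ 2 := by
    rw [h0]
    positivity
  obtain ⟨lam, ⟨hl0, hl⟩, hlz⟩ := sInf_lt_iff.1 hlt
  have hzt : z ≠ ∞ := hz1.ne_top
  have hlt : lam ≠ ∞ := (hlz.trans (ENNReal.pow_lt_top hzt.lt_top)).ne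
  obtain ⟨ht0, hmod⟩ := isAdmissible_toReal hs hf hl0 hlt hl
  set t := lam.toReal
  have htz : t ≤ z.toReal ^ 2 := by
    rw [← ENNReal.toReal_pow]
    exact ENNReal.toReal_mono (by finiteness) hlz.le
  have hzr : z.toReal ≤ 1 := by
    have := ENNReal.toReal_mono ENNReal.one_ne_top hz1.le
    simpa using this
  have hst : √t ≤ z.toReal := Real.sqrt_le_iff.2 ⟨ENNReal.toReal_nonneg, htz⟩
  have ht1 : t ≤ 1 := htz.trans (pow_le_one₀ ENNReal.toReal_nonneg hzr)
  have : I ≤ z := by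
    calc I ≤ ∫⁻ x in Q.toSet, ENNReal.ofReal √t * ENNReal.ofReal ((f x / t) ^ s x) := by
          refine lintegral_mono_ae (ae_restrict_of_ae ?_)
          filter_upwards [hs, hf] with x hx hfx
          rw [← ENNReal.ofReal_mul (Real.sqrt_nonneg t)]
          refine ENNReal.ofReal_le_ofReal ?_
          rw [Real.div_rpow hfx.le ht0.le, mul_div_assoc', le_div_iff₀ (by positivity), mul_comm,
            Real.sqrt_eq_rpow]
          gcongr ?_ * _
          exact Real.rpow_le_rpow_of_exponent_ge ht0 ht1 hx.2
      _ ≤ ENNReal.ofReal √t * 1 := by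
          rw [lintegral_const_mul' _ _ ENNReal.ofReal_ne_top]
          gcongr
      _ ≤ z := by
          rw [mul_one]
          exact ENNReal.ofReal_le_of_le_toReal hst
  exact absurd hzI this.not_gt

lemma exists_isAdmissible_le {n : ℕ} {r : Rn n → ℝ≥0∞} {s f : Rn n → ℝ} (Q : Cube n)
    (hs : ∀ᵐ x ∂(volume : Measure (Rn n)), r x = ENNReal.ofReal (s x) ∧ 1 / 2 ≤ s x)
    (hf : ∀ᵐ x ∂(volume : Measure (Rn n)), 0 < f x)
    (h0 : vNorm r (Q.toSet.indicator f) ≠ 0) (ht : vNorm r (Q.toSet.indicator f) ≠ ∞) :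
    ∃ t, IsAdmissible s f Q t ∧ ENNReal.ofReal t ≤ 2 * vNorm r (Q.toSet.indicator f) := by
  have hlt : vNorm r (Q.toSet.indicator f) < 2 * vNorm r (Q.toSet.indicator f) := by
    rw [two_mul]
    exact ENNReal.lt_add_right ht h0
  obtain ⟨lam, ⟨hl0, hl⟩, hlz⟩ := sInf_lt_iff.1 hlt
  have hlt : lam ≠ ∞ := hlz.ne_top
  exact ⟨lam.toReal, isAdmissible_toReal hs hf hl0 hlt hl,
    by rw [ENNReal.ofReal_toReal hlt]; exact hlz.le⟩

/-- The vector Muckenhoupt condition in terms of admissible numbers. -/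
lemma ApVec.exists_isAdmissible {n : ℕ} {p₁ p₂ p w₁ w₂ w r₁ r₂ : Rn n → ℝ}
    (hA : ApVec p₁ p₂ p w₁ w₂ w) (hd : DualTriple p r₁ r₂ w (fun x => (w₁ x)⁻¹) fun x => (w₂ x)⁻¹)
    (hp : ∀ᵐ x ∂(volume : Measure (Rn n)), 1 / 2 ≤ p x)
    (hr₁ : ∀ᵐ x ∂(volume : Measure (Rn n)), conjExp p₁ x = ENNReal.ofReal (r₁ x) ∧ 1 / 2 ≤ r₁ x)
    (hr₂ : ∀ᵐ x ∂(volume : Measure (Rn n)), conjExp p₂ x = ENNReal.ofReal (r₂ x) ∧ 1 / 2 ≤ r₂ x) :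
    ∃ A ≥ 1, ∀ Q : Cube n, ∃ t t₁ t₂, IsAdmissible p w Q t ∧
      IsAdmissible r₁ (fun x => (w₁ x)⁻¹) Q t₁ ∧ IsAdmissible r₂ (fun x => (w₂ x)⁻¹) Q t₂ ∧
      t * t₁ * t₂ ≤ A * (Q.side ^ n) ^ 2 := by
  obtain ⟨C, hC, hA⟩ := hA
  refine ⟨8 * C.toReal + 1, by linarith [C.toReal_nonneg], fun Q => ?_⟩
  have hQ := hA Q
  have hp' : ∀ᵐ x ∂(volume : Measure (Rn n)), ofExp p x = ENNReal.ofReal (p x) ∧ 1 / 2 ≤ p x :=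
    hp.mono fun x hx => ⟨rfl, hx⟩
  have f0 := hd.ae_pos.mono fun x hx => hx.1
  have f1 := hd.ae_pos.mono fun x hx => hx.2.1
  have f2 := hd.ae_pos.mono fun x hx => hx.2.2
  have n0 := vNorm_indicator_ne_zero Q hd.meas_r₁ hd.meas_f₁ hp' f0
  have n1 := vNorm_indicator_ne_zero Q hd.meas_r₂ hd.meas_f₂ hr₁ f1
  have n2 := vNorm_indicator_ne_zero Q hd.meas_r₃ hd.meas_f₃ hr₂ f2
  have hv : 0 < Q.side ^ n := pow_pos Q.side_pos n
  have hv0 : Q.vol ≠ 0 := by simpa [Cube.vol] using hv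
  have hvt : Q.vol ≠ ∞ := ENNReal.ofReal_ne_top
  have hvi : Q.vol⁻¹ ^ 2 ≠ 0 := pow_ne_zero _ (ENNReal.inv_ne_zero.2 hvt)
  have hfin := (hQ.trans_lt hC.lt_top).ne
  have hn2 : vNorm (conjExp p₂) (Q.toSet.indicator fun x => (w₂ x)⁻¹) ≠ ∞ := fun h =>
    hfin (by rw [h]; exact ENNReal.mul_top (mul_ne_zero (mul_ne_zero hvi n0) n1))
  have hfin' := ((ENNReal.mul_lt_top_iff.1 hfin.lt_top).resolve_right (by simp [n1, n2, n0, hvi])).1.ne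
  have hn1 : vNorm (conjExp p₁) (Q.toSet.indicator fun x => (w₁ x)⁻¹) ≠ ∞ := fun h =>
    hfin' (by rw [h]; exact ENNReal.mul_top (mul_ne_zero hvi n0))
  have hfin'' := ((ENNReal.mul_lt_top_iff.1 hfin'.lt_top).resolve_right (by simp [n1, n0, hvi])).1.ne
  have hn0 : vNorm (ofExp p) (Q.toSet.indicator w) ≠ ∞ := fun h =>
    hfin'' (by rw [h]; exact ENNReal.mul_top hvi)
  obtain ⟨t, ht, ht'⟩ := exists_isAdmissible_le Q hp' f0 n0 hn0
  obtain ⟨t₁, ht₁, ht₁'⟩ := exists_isAdmissible_le Q hr₁ f1 n1 hn1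
  obtain ⟨t₂, ht₂, ht₂'⟩ := exists_isAdmissible_le Q hr₂ f2 n2 hn2
  refine ⟨t, t₁, t₂, ht, ht₁, ht₂, ?_⟩
  have h0 := ht.1
  have h1 := ht₁.1
  have h2 := ht₂.1
  have key : ENNReal.ofReal (t * t₁ * t₂) ≤
      ENNReal.ofReal (8 * C.toReal * (Q.side ^ n) ^ 2) := by
    rw [ENNReal.ofReal_mul (by positivity), ENNReal.ofReal_mul (by positivity)]
    calc _ ≤ (2 * vNorm (ofExp p) (Q.toSet.indicator w)) *
          (2 * vNorm (conjExp p₁) (Q.toSet.indicator fun x => (w₁ x)⁻¹)) *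
          (2 * vNorm (conjExp p₂) (Q.toSet.indicator fun x => (w₂ x)⁻¹)) := by gcongr
      _ = 8 * (Q.vol ^ 2 * Q.vol⁻¹ ^ 2) * (vNorm (ofExp p) (Q.toSet.indicator w) *
          vNorm (conjExp p₁) (Q.toSet.indicator fun x => (w₁ x)⁻¹) *
          vNorm (conjExp p₂) (Q.toSet.indicator fun x => (w₂ x)⁻¹)) := by
          rw [← mul_pow, ENNReal.mul_inv_cancel hv0 hvt]
          ring
      _ = 8 * Q.vol ^ 2 * (Q.vol⁻¹ ^ 2 * vNorm (ofExp p) (Q.toSet.indicator w) *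
          vNorm (conjExp p₁) (Q.toSet.indicator fun x => (w₁ x)⁻¹) *
          vNorm (conjExp p₂) (Q.toSet.indicator fun x => (w₂ x)⁻¹)) := by ring
      _ ≤ 8 * Q.vol ^ 2 * C := by gcongr
      _ = _ := by
          rw [ENNReal.ofReal_mul (by positivity), ENNReal.ofReal_mul (by positivity),
            ENNReal.ofReal_toReal hC, ENNReal.ofReal_pow hv.le, Cube.vol]
          simp only [ENNReal.ofReal_ofNat]
          ring
  have := (ENNReal.ofReal_le_ofReal_iff (by positivity)).1 key
  nlinarith [pow_pos hv 2]

/-- Trading the exponent `q` for a larger one costs a factor controlled by the oscillation. -/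
lemma rpow_le_exp_mul_rpow {t q p M : ℝ} (ht : 0 < t) (h : (p - q) * (-Real.log t) ≤ M) :
    t ^ q ≤ Real.exp M * t ^ p := by
  rw [Real.rpow_def_of_pos ht, Real.rpow_def_of_pos ht, ← Real.exp_add]
  exact Real.exp_le_exp.2 (by linarith)

lemma div_sub_one_mul_one_sub {z : ℝ} (hz : 1 < z) : z / (z - 1) * (1 - 1 / z) = 1 := by
  have : z - 1 ≠ 0 := by linarith
  field_simp

/-- `σ(Q)^{1/s}` is dominated by the norm of `v⁻¹` on `Q`, for the conjugate exponent `s` of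
`(r)₋(Q)`. -/
lemma lintegral_rpow_conj_le {n : ℕ} {r v σ : Rn n → ℝ} {Q : Cube n} {a b K t : ℝ} (ha : 1 < a)
    (hb : ∀ᵐ x ∂(volume : Measure (Rn n)), a ≤ r x ∧ r x ≤ b)
    (hv : ∀ᵐ x ∂(volume : Measure (Rn n)), 0 < v x)
    (hσ : ∀ x, σ x = v x ^ (-(r x / (r x - 1)))) (hK : 0 ≤ K)
    (ht : IsAdmissible (fun x => r x / (r x - 1)) (fun x => (v x)⁻¹) Q t)
    (hosc : ∀ᵐ x ∂(volume.restrict Q.toSet),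
      (1 / pMinusOn r Q - 1 / r x) * (-Real.log t) ≤ K) :
    ∫⁻ x in Q.toSet, ENNReal.ofReal (σ x) ≤
      ENNReal.ofReal (Real.exp ((a / (a - 1)) ^ 2 * K) *
        t ^ (pMinusOn r Q / (pMinusOn r Q - 1))) := by
  obtain ⟨ht0, hmod⟩ := ht
  have hm : a ≤ pMinusOn r Q := le_pMinusOn Q (ae_restrict_of_ae (hb.mono fun x hx => hx.2))
    (ae_restrict_of_ae (hb.mono fun x hx => hx.1))
  set m := pMinusOn r Q
  have hconj : ∀ z, a ≤ z → 0 < z / (z - 1) ∧ z / (z - 1) ≤ a / (a - 1) := by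
    intro z hz
    have h1 : 0 < z - 1 := by linarith
    have h2 : 0 < a - 1 := by linarith
    refine ⟨div_pos (by linarith) h1, ?_⟩
    rw [div_le_div_iff₀ h1 h2]
    nlinarith
  set D := Real.exp ((a / (a - 1)) ^ 2 * K) * t ^ (m / (m - 1)) with hD
  have hD0 : 0 ≤ D := by positivity
  calc _ ≤ ∫⁻ x in Q.toSet, ENNReal.ofReal D *
        ENNReal.ofReal (((v x)⁻¹ / t) ^ (r x / (r x - 1))) := by
        refine lintegral_mono_ae ?_
        filter_upwards [ae_restrict_of_ae hb, ae_restrict_of_ae hv, hosc] with x hx hvx ho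
        rw [← ENNReal.ofReal_mul hD0, hσ]
        refine ENNReal.ofReal_le_ofReal ?_
        obtain ⟨c1, c2⟩ := hconj (r x) hx.1
        obtain ⟨c3, c4⟩ := hconj m hm
        have h1 : (m / (m - 1) - r x / (r x - 1)) * (-Real.log t) ≤ (a / (a - 1)) ^ 2 * K := by
          have e : m / (m - 1) - r x / (r x - 1) =
              (m / (m - 1) * (r x / (r x - 1))) * (1 / m - 1 / r x) := by
            have d1 : m - 1 ≠ 0 := by linarith
            have d2 : r x - 1 ≠ 0 := by linarith [hx.1]
            have d3 : m ≠ 0 := by linarith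
            have d4 : r x ≠ 0 := by linarith [hx.1]
            field_simp
            ring
          rw [e, mul_assoc, pow_two]
          calc _ ≤ (m / (m - 1) * (r x / (r x - 1))) * K := by gcongr
            _ ≤ _ := by gcongr
        have h2 := rpow_le_exp_mul_rpow ht0 h1
        rw [Real.div_rpow (by positivity) ht0.le, Real.inv_rpow hvx.le, ← Real.rpow_neg hvx.le,
          mul_div_assoc', le_div_iff₀ (by positivity), mul_comm]
        gcongr
    _ ≤ ENNReal.ofReal D * 1 := by
        rw [lintegral_const_mul' _ _ ENNReal.ofReal_ne_top]
        gcongr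
    _ = _ := mul_one _

lemma rpow_le_ofReal_of_le {S : ℝ≥0∞} {D B t m q : ℝ} (hD : 1 ≤ D) (ht : 0 < t) (hm : 1 < m)
    (hq : 0 ≤ q) (hqB : q ≤ B) (hS : S ≤ ENNReal.ofReal (D * t ^ (m / (m - 1)))) :
    S ^ q ≤ S ^ (q / m) * ENNReal.ofReal (D ^ B * t ^ q) := by
  have hm0 : 0 < m := by linarith
  have h1 : 0 ≤ 1 - 1 / m := by
    rw [sub_nonneg, div_le_one hm0]
    exact hm.le
  have h1' : 1 - 1 / m ≤ 1 := by
    have : 0 < 1 / m := by positivity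
    linarith
  have h2 : q = q / m + q * (1 - 1 / m) := by ring
  conv_lhs => rw [h2]
  rw [ENNReal.rpow_add_of_nonneg _ _ (by positivity) (by positivity)]
  gcongr
  refine (ENNReal.rpow_le_rpow hS (by positivity)).trans ?_
  rw [ENNReal.ofReal_rpow_of_nonneg (by positivity) (by positivity)]
  refine ENNReal.ofReal_le_ofReal ?_
  rw [Real.mul_rpow (by positivity) (by positivity), ← Real.rpow_mul ht.le,
    show m / (m - 1) * (q * (1 - 1 / m)) = q * (m / (m - 1) * (1 - 1 / m)) by ring,
    div_sub_one_mul_one_sub hm, mul_one]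
  gcongr
  nlinarith

lemma conjExp_eq {n : ℕ} {r : Rn n → ℝ} {a b : ℝ} (ha : 1 < a)
    (hb : ∀ᵐ x ∂(volume : Measure (Rn n)), a ≤ r x ∧ r x ≤ b) :
    ∀ᵐ x ∂(volume : Measure (Rn n)), conjExp r x = ENNReal.ofReal (r x / (r x - 1)) ∧
      1 / 2 ≤ r x / (r x - 1) := by
  filter_upwards [hb] with x hx
  have h1 : 1 < r x := by linarith [hx.1]
  constructor
  · rw [conjExp, econj, if_neg, if_neg ENNReal.ofReal_ne_top, ENNReal.toReal_ofReal (by linarith)]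
    rw [ENNReal.ofReal_eq_one]
    exact h1.ne'
  · rw [le_div_iff₀ (by linarith)]
    linarith

/-- The pointwise inequality for real numbers behind the integral estimate. -/
lemma mul_rpow_le_of_mul_le {A B E t t₁ t₂ V v p q : ℝ} (hA : 1 ≤ A) (ht : 0 < t) (ht₁ : 0 < t₁)
    (ht₂ : 0 < t₂) (hV : 0 < V) (hv : 0 < v) (hE : 0 ≤ E) (hp : 0 ≤ p) (hpB : p ≤ B)
    (h : t * t₁ * t₂ ≤ A * V ^ 2) (h₁ : t₁ ^ q ≤ E * t₁ ^ p) (h₂ : t₂ ^ q ≤ E * t₂ ^ p) :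
    t₁ ^ q * t₂ ^ q * V ^ (-(2 * p)) * v ^ p ≤ E ^ 2 * A ^ B * (v / t) ^ p := by
  have h3 : (t * t₁ * t₂) ^ p ≤ A ^ B * V ^ (2 * p) := by
    calc _ ≤ (A * V ^ 2) ^ p := Real.rpow_le_rpow (by positivity) h hp
      _ = A ^ p * V ^ (2 * p) := by
          rw [Real.mul_rpow (by positivity) (by positivity), Real.rpow_mul hV.le]
          norm_num
      _ ≤ _ := by gcongr
  rw [Real.mul_rpow (by positivity) ht₂.le, Real.mul_rpow ht.le ht₁.le] at h3
  have h4 : t₁ ^ q * t₂ ^ q ≤ E * t₁ ^ p * (E * t₂ ^ p) := by gcongr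
  rw [Real.rpow_neg hV.le, Real.div_rpow hv.le ht.le, mul_div_assoc', le_div_iff₀ (by positivity),
    ← div_eq_mul_inv, div_mul_eq_mul_div, div_mul_eq_mul_div, div_le_iff₀ (by positivity)]
  calc _ ≤ E * t₁ ^ p * (E * t₂ ^ p) * v ^ p * t ^ p := by gcongr
    _ = E ^ 2 * v ^ p * (t ^ p * t₁ ^ p * t₂ ^ p) := by ring
    _ ≤ E ^ 2 * v ^ p * (A ^ B * V ^ (2 * p)) := by gcongr
    _ = _ := by ring

/-- the integral estimate
`∫_E σ₁(Q)^{q(Q)} σ₂(Q)^{q(Q)} |Q|^{-2p(x)} u(x) dx ≲ σ₁(Q)^{q(Q)/(p₁)₋(Q)} σ₂(Q)^{q(Q)/(p₂)₋(Q)}`. -/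
theorem statement12 {n : ℕ} (p₁ p₂ p w₁ w₂ w u σ₁ σ₂ : Rn n → ℝ)
    (hp₁m : Measurable p₁) (hp₂m : Measurable p₂)
    (hp₁1 : ∀ x, 1 ≤ p₁ x) (hp₂1 : ∀ x, 1 ≤ p₂ x)
    (hp₁b : ∃ a b : ℝ, 1 < a ∧ ∀ᵐ x ∂(volume : Measure (Rn n)), a ≤ p₁ x ∧ p₁ x ≤ b)
    (hp₂b : ∃ a b : ℝ, 1 < a ∧ ∀ᵐ x ∂(volume : Measure (Rn n)), a ≤ p₂ x ∧ p₂ x ≤ b)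
    (hp₁LH : LH p₁) (hp₂LH : LH p₂)
    (hp : ∀ x, 1 / p x = 1 / p₁ x + 1 / p₂ x)
    (hw₁ : IsWeight w₁) (hw₂ : IsWeight w₂)
    (hw : ∀ x, w x = w₁ x * w₂ x)
    (hA : ApVec p₁ p₂ p w₁ w₂ w)
    (hu : ∀ x, u x = w x ^ p x)
    (hσ₁ : ∀ x, σ₁ x = w₁ x ^ (-(p₁ x / (p₁ x - 1))))
    (hσ₂ : ∀ x, σ₂ x = w₂ x ^ (-(p₂ x / (p₂ x - 1)))) :
    ∃ C : ℝ≥0∞, C ≠ ∞ ∧ ∀ (Q : Cube n) (E : Set (Rn n)), MeasurableSet E → E ⊆ Q.toSet →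
      (∫⁻ x in E,
          (∫⁻ y in Q.toSet, ENNReal.ofReal (σ₁ y)) ^ qExp p₁ p₂ Q *
            (∫⁻ y in Q.toSet, ENNReal.ofReal (σ₂ y)) ^ qExp p₁ p₂ Q *
              Q.vol ^ (-(2 * p x)) * ENNReal.ofReal (u x)) ≤
        C * (∫⁻ y in Q.toSet, ENNReal.ofReal (σ₁ y)) ^ (qExp p₁ p₂ Q / pMinusOn p₁ Q) *
          (∫⁻ y in Q.toSet, ENNReal.ofReal (σ₂ y)) ^ (qExp p₁ p₂ Q / pMinusOn p₂ Q) := by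
  obtain ⟨a₁, b₁, ha₁, hb₁⟩ := hp₁b
  obtain ⟨a₂, b₂, ha₂, hb₂⟩ := hp₂b
  obtain ⟨hw₁m, hw₁0⟩ := hw₁
  obtain ⟨hw₂m, hw₂0⟩ := hw₂
  have hpos₁ : ∀ x, 0 < p₁ x := fun x => zero_lt_one.trans_le (hp₁1 x)
  have hpos₂ : ∀ x, 0 < p₂ x := fun x => zero_lt_one.trans_le (hp₂1 x)
  have hpp : ∀ x, 0 < 1 / p x := fun x => by
    rw [hp]
    exact add_pos (one_div_pos.2 (hpos₁ x)) (one_div_pos.2 (hpos₂ x))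
  have hp0 : ∀ x, 0 < p x := fun x => one_div_pos.1 (hpp x)
  have hphalf : ∀ x, 1 / 2 ≤ p x := fun x => by
    rw [one_div_le (by norm_num) (hp0 x), hp]
    have h1 : 1 / p₁ x ≤ 1 := (div_le_one (hpos₁ x)).2 (hp₁1 x)
    have h2 : 1 / p₂ x ≤ 1 := (div_le_one (hpos₂ x)).2 (hp₂1 x)
    linarith
  have hpm : Measurable p := by
    have : p = fun x => 1 / (1 / p₁ x + 1 / p₂ x) := by
      funext x
      rw [← hp, one_div_one_div]
    rw [this]
    fun_prop
  have hwm : Measurable w := by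
    rw [show w = fun x => w₁ x * w₂ x from funext hw]
    fun_prop
  have hd : DualTriple p (fun x => p₁ x / (p₁ x - 1)) (fun x => p₂ x / (p₂ x - 1)) w
      (fun x => (w₁ x)⁻¹) (fun x => (w₂ x)⁻¹) :=
    { meas_r₁ := hpm
      meas_r₂ := by fun_prop
      meas_r₃ := by fun_prop
      meas_f₁ := hwm
      meas_f₂ := by fun_prop
      meas_f₃ := by fun_prop
      ae_pos := by
        filter_upwards [hw₁0, hw₂0] with x h1 h2
        rw [hw]
        exact ⟨by positivity, by positivity, by positivity⟩
      ae_prod := by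
        filter_upwards [hw₁0, hw₂0] with x h1 h2
        rw [hw]
        field_simp
      ae_exp_pos := by
        filter_upwards [hb₁, hb₂] with x h1 h2
        have e1 : 0 < p₁ x - 1 := by linarith [h1.1]
        have e2 : 0 < p₂ x - 1 := by linarith [h2.1]
        have := hpos₁ x
        have := hpos₂ x
        exact ⟨hp0 x, by positivity, by positivity⟩
      ae_exp := by
        filter_upwards [hb₁, hb₂] with x h1 h2
        have e1 : 0 < p₁ x - 1 := by linarith [h1.1]
        have e2 : 0 < p₂ x - 1 := by linarith [h2.1]
        have := hpos₁ x
        have := hpos₂ x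
        rw [hp]
        field_simp
        ring }
  obtain ⟨A, hA1, hA⟩ := hA.exists_isAdmissible hd (Filter.Eventually.of_forall hphalf)
    (conjExp_eq ha₁ hb₁) (conjExp_eq ha₂ hb₂)
  obtain ⟨c₁, hc₁, hlow₁⟩ := hd.rotate.exists_lower_bound (A := A) fun Q => by
    obtain ⟨t, t₁, t₂, h, h₁, h₂, hle⟩ := hA Q
    exact ⟨t₁, t₂, t, h₁, h₂, h, by linarith⟩
  obtain ⟨c₂, hc₂, hlow₂⟩ := hd.rotate.rotate.exists_lower_bound (A := A) fun Q => by
    obtain ⟨t, t₁, t₂, h, h₁, h₂, hle⟩ := hA Q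
    exact ⟨t₂, t, t₁, h₂, h, h₁, by linarith⟩
  obtain ⟨K₁₁, hK₁₁, hosc₁₁⟩ := hp₁LH.sub_mul_neg_log_le hp₁1 hc₁ (n * 2)
  obtain ⟨K₁₂, hK₁₂, hosc₁₂⟩ := hp₁LH.sub_mul_neg_log_le hp₁1 hc₂ (n * 2)
  obtain ⟨K₂₁, hK₂₁, hosc₂₁⟩ := hp₂LH.sub_mul_neg_log_le hp₂1 hc₁ (n * 2)
  obtain ⟨K₂₂, hK₂₂, hosc₂₂⟩ := hp₂LH.sub_mul_neg_log_le hp₂1 hc₂ (n * 2)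
  set K := K₁₁ + K₁₂ + K₂₁ + K₂₂ with hK
  have hK0 : 0 ≤ K := by positivity
  set D₁ := Real.exp ((a₁ / (a₁ - 1)) ^ 2 * K₁₁)
  set D₂ := Real.exp ((a₂ / (a₂ - 1)) ^ 2 * K₂₂)
  have hD₁ : 1 ≤ D₁ := Real.one_le_exp (by positivity)
  have hD₂ : 1 ≤ D₂ := Real.one_le_exp (by positivity)
  set F := Real.exp (b₁ * b₁ * K)
  refine ⟨ENNReal.ofReal (D₁ ^ b₁ * D₂ ^ b₁ * (F ^ 2 * A ^ b₁)), ENNReal.ofReal_ne_top,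
    fun Q E _ hEQ => ?_⟩
  obtain ⟨t, t₁, t₂, ht, ht₁, ht₂, hle⟩ := hA Q
  have ub₁ := ae_restrict_of_ae (s := Q.toSet) (hb₁.mono fun x hx => hx.2)
  have ub₂ := ae_restrict_of_ae (s := Q.toSet) (hb₂.mono fun x hx => hx.2)
  have o₁₁ := inv_pMinusOn_sub_mul_le hp₁1 ub₁ hK₁₁ (hosc₁₁ Q t₁ (hlow₁ Q t₁ ht₁))
  have o₁₂ := inv_pMinusOn_sub_mul_le hp₁1 ub₁ hK₁₂ (hosc₁₂ Q t₂ (hlow₂ Q t₂ ht₂))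
  have o₂₁ := inv_pMinusOn_sub_mul_le hp₂1 ub₂ hK₂₁ (hosc₂₁ Q t₁ (hlow₁ Q t₁ ht₁))
  have o₂₂ := inv_pMinusOn_sub_mul_le hp₂1 ub₂ hK₂₂ (hosc₂₂ Q t₂ (hlow₂ Q t₂ ht₂))
  have hS₁ := lintegral_rpow_conj_le ha₁ hb₁ hw₁0 hσ₁ hK₁₁ ht₁ o₁₁
  have hS₂ := lintegral_rpow_conj_le ha₂ hb₂ hw₂0 hσ₂ hK₂₂ ht₂ o₂₂
  have hm₁ : a₁ ≤ pMinusOn p₁ Q := le_pMinusOn Q ub₁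
    (ae_restrict_of_ae (hb₁.mono fun x hx => hx.1))
  have hm₂ : a₂ ≤ pMinusOn p₂ Q := le_pMinusOn Q ub₂
    (ae_restrict_of_ae (hb₂.mono fun x hx => hx.1))
  have hmb₁ : pMinusOn p₁ Q ≤ b₁ := by
    have := Q.ae_restrict_neBot
    obtain ⟨x, h1, h2⟩ := ((pMinusOn_le_ae hp₁1 Q).and ub₁).exists
    exact h1.trans h2
  set S₁ := ∫⁻ y in Q.toSet, ENNReal.ofReal (σ₁ y)
  set S₂ := ∫⁻ y in Q.toSet, ENNReal.ofReal (σ₂ y)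
  have hq : 1 / qExp p₁ p₂ Q = 1 / pMinusOn p₁ Q + 1 / pMinusOn p₂ Q := by
    simp [qExp]
  set m₁ := pMinusOn p₁ Q
  set m₂ := pMinusOn p₂ Q
  set q := qExp p₁ p₂ Q
  have hm₁0 : 0 < 1 / m₁ := one_div_pos.2 (by linarith)
  have hm₂0 : 0 < 1 / m₂ := one_div_pos.2 (by linarith)
  have hq0 : 0 < q := one_div_pos.1 (by rw [hq]; positivity)
  have hqb : q ≤ b₁ := by
    refine le_trans ?_ hmb₁
    rw [← one_div_le_one_div (by linarith) hq0, hq]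
    linarith
  have hb₁0 : 0 < b₁ := hq0.trans_le hqb
  have hs : 0 < Q.side ^ n := pow_pos Q.side_pos n
  have ht0 := ht.1
  have ht₁0 := ht₁.1
  have ht₂0 := ht₂.1
  have hT₁ := rpow_le_ofReal_of_le hD₁ ht₁0 (ha₁.trans_le hm₁) hq0.le hqb hS₁
  have hT₂ := rpow_le_ofReal_of_le hD₂ ht₂0 (ha₂.trans_le hm₂) hq0.le hqb hS₂
  have hfin₁ : S₁ ^ (q / m₁) ≠ ∞ :=
    ENNReal.rpow_ne_top_of_nonneg (div_nonneg hq0.le (by linarith))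
      (hS₁.trans_lt ENNReal.ofReal_lt_top).ne
  have hfin₂ : S₂ ^ (q / m₂) ≠ ∞ :=
    ENNReal.rpow_ne_top_of_nonneg (div_nonneg hq0.le (by linarith))
      (hS₂.trans_lt ENNReal.ofReal_lt_top).ne
  set M := ENNReal.ofReal (D₁ ^ b₁ * D₂ ^ b₁ * (F ^ 2 * A ^ b₁))
  have hpt : ∀ᵐ x ∂(volume.restrict Q.toSet),
      S₁ ^ q * S₂ ^ q * Q.vol ^ (-(2 * p x)) * ENNReal.ofReal (u x) ≤
        M * S₁ ^ (q / m₁) * S₂ ^ (q / m₂) * ENNReal.ofReal ((w x / t) ^ p x) := by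
    filter_upwards [o₁₁, o₁₂, o₂₁, o₂₂, ub₁, ae_restrict_of_ae hw₁0, ae_restrict_of_ae hw₂0]
      with x y₁₁ y₁₂ y₂₁ y₂₂ hxb hx₁ hx₂
    have hwx : 0 < w x := by
      rw [hw]
      positivity
    have hpx := hp0 x
    have hpb : p x ≤ b₁ := by
      refine le_trans ?_ hxb
      rw [← one_div_le_one_div (hpos₁ x) hpx, hp]
      linarith [one_div_pos.2 (hpos₂ x)]
    have hdiff : p x - q = p x * q * ((1 / m₁ - 1 / p₁ x) + (1 / m₂ - 1 / p₂ x)) := by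
      rw [show (1 / m₁ - 1 / p₁ x) + (1 / m₂ - 1 / p₂ x) = 1 / q - 1 / p x by
        rw [hq, hp]; ring]
      field_simp
    have hexp : ∀ τ : ℝ, (1 / m₁ - 1 / p₁ x) * (-Real.log τ) +
        (1 / m₂ - 1 / p₂ x) * (-Real.log τ) ≤ K → (p x - q) * (-Real.log τ) ≤ b₁ * b₁ * K := by
      intro τ h
      rw [hdiff, mul_assoc, add_mul]
      calc _ ≤ p x * q * K := by gcongr
        _ ≤ _ := by gcongr
    have hE₁ : t₁ ^ q ≤ F * t₁ ^ p x := rpow_le_exp_mul_rpow ht₁0 (hexp t₁ (by linarith))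
    have hE₂ : t₂ ^ q ≤ F * t₂ ^ p x := rpow_le_exp_mul_rpow ht₂0 (hexp t₂ (by linarith))
    have hreal := mul_rpow_le_of_mul_le hA1 ht0 ht₁0 ht₂0 hs hwx (Real.exp_pos _).le hpx.le hpb
      hle hE₁ hE₂
    calc _ ≤ (S₁ ^ (q / m₁) * ENNReal.ofReal (D₁ ^ b₁ * t₁ ^ q)) *
          (S₂ ^ (q / m₂) * ENNReal.ofReal (D₂ ^ b₁ * t₂ ^ q)) *
          ENNReal.ofReal ((Q.side ^ n) ^ (-(2 * p x))) * ENNReal.ofReal (w x ^ p x) := by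
          rw [hu, Cube.vol, ENNReal.ofReal_rpow_of_pos hs]
          gcongr
      _ = S₁ ^ (q / m₁) * S₂ ^ (q / m₂) * (ENNReal.ofReal (D₁ ^ b₁ * t₁ ^ q) *
          ENNReal.ofReal (D₂ ^ b₁ * t₂ ^ q) * ENNReal.ofReal ((Q.side ^ n) ^ (-(2 * p x))) *
          ENNReal.ofReal (w x ^ p x)) := by ring
      _ ≤ S₁ ^ (q / m₁) * S₂ ^ (q / m₂) * (M * ENNReal.ofReal ((w x / t) ^ p x)) := by
          rw [← ENNReal.ofReal_mul (by positivity), ← ENNReal.ofReal_mul (by positivity),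
            ← ENNReal.ofReal_mul (by positivity), ← ENNReal.ofReal_mul (by positivity)]
          refine mul_le_mul' le_rfl (ENNReal.ofReal_le_ofReal ?_)
          calc _ = D₁ ^ b₁ * D₂ ^ b₁ *
                (t₁ ^ q * t₂ ^ q * (Q.side ^ n) ^ (-(2 * p x)) * w x ^ p x) := by ring
            _ ≤ D₁ ^ b₁ * D₂ ^ b₁ * (F ^ 2 * A ^ b₁ * (w x / t) ^ p x) := by gcongr
            _ = _ := by ring
      _ = _ := by ring
  calc _ ≤ ∫⁻ x in Q.toSet,
        S₁ ^ q * S₂ ^ q * Q.vol ^ (-(2 * p x)) * ENNReal.ofReal (u x) := lintegral_mono_set hEQ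
    _ ≤ ∫⁻ x in Q.toSet,
        M * S₁ ^ (q / m₁) * S₂ ^ (q / m₂) * ENNReal.ofReal ((w x / t) ^ p x) :=
      lintegral_mono_ae hpt
    _ = M * S₁ ^ (q / m₁) * S₂ ^ (q / m₂) *
        ∫⁻ x in Q.toSet, ENNReal.ofReal ((w x / t) ^ p x) :=
      lintegral_const_mul' _ _ (ENNReal.mul_ne_top (ENNReal.mul_ne_top ENNReal.ofReal_ne_top hfin₁)
        hfin₂)
    _ ≤ M * S₁ ^ (q / m₁) * S₂ ^ (q / m₂) * 1 := by
        gcongr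
        exact ht.2
    _ = _ := mul_one _
end
end

section
/- Let p₁(·), p₂(·) : ℝⁿ → [1,∞) be measurable exponent functions with (pⱼ)₊ < ∞, define p(·) by 1/p(x) = 1/p₁(x) + 1/p₂(x), and let w₁, w₂ be weights with w = w₁w₂. If (w₁,w₂,w) ∈ A_{p⃗(·)}, then there is a constant C such that for every cube Q, ∫_Q (‖w₁^{−1}χ_Q‖_{p₁'(·)}‖w₂^{−1}χ_Q‖_{p₂'(·)})^{p(x)}|Q|^{−2p(x)}w(x)^{p(x)} dx ≤ C. -/
open MeasureTheory ENNReal Set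

noncomputable section

lemma lintegral_div_rpow_le_eModular {n : ℕ} {p : Rn n → ℝ} (hp : ∀ x, 0 ≤ p x)
    (μ : Measure (Rn n)) (f : Rn n → ℝ≥0∞) (lam : ℝ≥0∞) :
    ∫⁻ x, (f x / lam) ^ p x ∂μ ≤ eModular (ofExp p) μ f lam := by
  have hset : {x | ofExp p x ≠ ∞} = univ := by ext x; simp [ofExp]
  have hreal : ∀ x, (ofExp p x).toReal = p x := fun x => ENNReal.toReal_ofReal (hp x)
  simp only [eModular, hset, hreal, Measure.restrict_univ]
  exact le_self_add

/-- The norm inequality `K ‖f‖_{p(·)} < D` controls the modular of `K f`. -/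
lemma lintegral_mul_rpow_le_of_mul_eNorm_lt {n : ℕ} {p : Rn n → ℝ} {b : ℝ}
    {μ : Measure (Rn n)} {f : Rn n → ℝ≥0∞} {K D : ℝ≥0∞} (hp : ∀ x, 0 ≤ p x)
    (hpb : ∀ᵐ x ∂μ, p x ≤ b) (hb : 0 ≤ b) (hK₀ : K ≠ 0) (hK : K ≠ ∞) (hD₁ : 1 ≤ D)
    (hD : D ≠ ∞) (h : K * eNorm (ofExp p) μ f < D) :
    ∫⁻ x, (K * f x) ^ p x ∂μ ≤ D ^ b := by
  have hlt : eNorm (ofExp p) μ f < D / K := by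
    rw [ENNReal.lt_div_iff_mul_lt (Or.inl hK₀) (Or.inl hK), mul_comm]
    exact h
  obtain ⟨l, ⟨hl₀, hl⟩, hlD⟩ := sInf_lt_iff.1 hlt
  have hl_top : l ≠ ∞ := hlD.ne_top
  have hKl : l * K ≤ D := ((ENNReal.lt_div_iff_mul_lt (Or.inl hK₀) (Or.inl hK)).1 hlD).le
  calc ∫⁻ x, (K * f x) ^ p x ∂μ ≤ ∫⁻ x, D ^ b * (f x / l) ^ p x ∂μ := by
        refine lintegral_mono_ae ?_
        filter_upwards [hpb] with x hx
        have hsplit : K * f x = (l * K) * (f x / l) := by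
          rw [mul_comm l K, mul_assoc, ENNReal.mul_div_cancel hl₀ hl_top]
        rw [hsplit, ENNReal.mul_rpow_of_nonneg _ _ (hp x)]
        gcongr
        exact (ENNReal.rpow_le_rpow hKl (hp x)).trans (ENNReal.rpow_le_rpow_of_exponent_le hD₁ hx)
    _ = D ^ b * ∫⁻ x, (f x / l) ^ p x ∂μ :=
        lintegral_const_mul' _ _ (ENNReal.rpow_ne_top_of_nonneg hb hD)
    _ ≤ D ^ b * 1 := by
        gcongr
        exact (lintegral_div_rpow_le_eModular hp μ f l).trans hl
    _ = D ^ b := mul_one _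

lemma ae_eq_zero_of_eNorm_eq_zero {n : ℕ} {p : Rn n → ℝ} {c : ℝ} {μ : Measure (Rn n)}
    {f : Rn n → ℝ≥0∞} (hpm : Measurable p) (hf : Measurable f) (hc : 0 < c)
    (hcp : ∀ x, c ≤ p x) (h : eNorm (ofExp p) μ f = 0) : f =ᵐ[μ] 0 := by
  have hp : ∀ x, 0 < p x := fun x => hc.trans_le (hcp x)
  have hmod : ∫⁻ x, f x ^ p x ∂μ = 0 := by
    by_contra hI
    have hlt : eNorm (ofExp p) μ f < min 1 ((∫⁻ x, f x ^ p x ∂μ) ^ c⁻¹) := by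
      rw [h, lt_min_iff]
      exact ⟨one_pos, ENNReal.rpow_pos_of_nonneg (pos_iff_ne_zero.2 hI) (inv_nonneg.2 hc.le)⟩
    obtain ⟨l, ⟨hl₀, hl⟩, hlI⟩ := sInf_lt_iff.1 hlt
    obtain ⟨hl₁, hlI⟩ := lt_min_iff.1 hlI
    have hlc : l ^ c ≠ ∞ := ENNReal.rpow_ne_top_of_nonneg hc.le hl₁.ne_top
    have hle : ∫⁻ x, f x ^ p x ∂μ ≤ l ^ c := by
      have hpt : ∀ x, f x ^ p x ≤ l ^ c * (f x / l) ^ p x := by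
        intro x
        calc f x ^ p x = l ^ p x * (f x / l) ^ p x := by
              rw [← ENNReal.mul_rpow_of_nonneg _ _ (hp x).le,
                ENNReal.mul_div_cancel hl₀ hl₁.ne_top]
          _ ≤ l ^ c * (f x / l) ^ p x := by
              exact mul_le_mul_left (ENNReal.rpow_le_rpow_of_exponent_ge hl₁.le (hcp x)) _
      calc ∫⁻ x, f x ^ p x ∂μ ≤ ∫⁻ x, l ^ c * (f x / l) ^ p x ∂μ := lintegral_mono hpt
        _ = l ^ c * ∫⁻ x, (f x / l) ^ p x ∂μ := lintegral_const_mul' _ _ hlc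
        _ ≤ l ^ c * 1 := by
            gcongr
            exact (lintegral_div_rpow_le_eModular (fun x => (hp x).le) μ f l).trans hl
        _ = l ^ c := mul_one _
    have := ENNReal.rpow_lt_rpow hlI hc
    rw [ENNReal.rpow_inv_rpow hc.ne'] at this
    exact (hle.trans_lt this).false
  rw [lintegral_eq_zero_iff (hf.pow hpm)] at hmod
  filter_upwards [hmod] with x hx
  exact (ENNReal.rpow_eq_zero_iff_of_pos (hp x)).1 hx

namespace Cube

lemma toSet_eq_pi {n : ℕ} (Q : Cube n) :
    Q.toSet = univ.pi fun i => Ico (Q.base i) (Q.base i + Q.side) := by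
  ext x; simp [toSet]

lemma volume_toSet_ne_zero {n : ℕ} (Q : Cube n) : volume Q.toSet ≠ 0 := by
  rw [toSet_eq_pi, volume_pi_pi]
  simp [Q.side_pos]

end Cube

lemma vNorm_indicator_ne_zero_s14 {n : ℕ} {p w : Rn n → ℝ} {c : ℝ} (hpm : Measurable p)
    (hc : 0 < c) (hcp : ∀ x, c ≤ p x) (hwm : Measurable w)
    (hw : ∀ᵐ x ∂(volume : Measure (Rn n)), 0 < w x) (Q : Cube n) :
    vNorm (ofExp p) (Q.toSet.indicator w) ≠ 0 := by
  intro h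
  have hzero := ae_eq_zero_of_eNorm_eq_zero hpm
    (hwm.indicator Q.measurableSet_toSet).abs.ennreal_ofReal hc hcp h
  refine Q.volume_toSet_ne_zero (measure_eq_zero_iff_ae_notMem.2 ?_)
  filter_upwards [hzero, hw] with x hx hwx hxQ
  simp [indicator_of_mem hxQ, hwx.ne'] at hx

/-- the modular form of the `A_{p⃗(·)}` condition:
`∫_Q (‖w₁^{-1}χ_Q‖_{p₁'(·)}‖w₂^{-1}χ_Q‖_{p₂'(·)})^{p(x)} |Q|^{-2p(x)} w(x)^{p(x)} dx ≲ 1`. -/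
theorem statement14 {n : ℕ} (p₁ p₂ p w₁ w₂ w : Rn n → ℝ)
    (hp₁m : Measurable p₁) (hp₂m : Measurable p₂)
    (hp₁1 : ∀ x, 1 ≤ p₁ x) (hp₂1 : ∀ x, 1 ≤ p₂ x)
    (hp₁ub : ∃ b : ℝ, ∀ᵐ x ∂(volume : Measure (Rn n)), p₁ x ≤ b)
    (hp₂ub : ∃ b : ℝ, ∀ᵐ x ∂(volume : Measure (Rn n)), p₂ x ≤ b)
    (hp : ∀ x, 1 / p x = 1 / p₁ x + 1 / p₂ x)
    (hw₁ : IsWeight w₁) (hw₂ : IsWeight w₂)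
    (hw : ∀ x, w x = w₁ x * w₂ x)
    (hA : ApVec p₁ p₂ p w₁ w₂ w) :
    ∃ C : ℝ≥0∞, C ≠ ∞ ∧ ∀ Q : Cube n,
      (∫⁻ x in Q.toSet,
          (vNorm (conjExp p₁) (Q.toSet.indicator fun y => (w₁ y)⁻¹) *
              vNorm (conjExp p₂) (Q.toSet.indicator fun y => (w₂ y)⁻¹)) ^ p x *
            Q.vol ^ (-(2 * p x)) * ENNReal.ofReal (w x ^ p x)) ≤ C := by
  obtain ⟨b, hb⟩ := hp₁ub
  obtain ⟨C, hC, hA⟩ := hA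
  have hp_eq : p = fun x => (1 / p₁ x + 1 / p₂ x)⁻¹ := by
    funext x
    rw [← hp x, one_div, inv_inv]
  have hpm : Measurable p := by
    rw [hp_eq]
    fun_prop
  have hp_half : ∀ x, 1 / 2 ≤ p x := by
    intro x
    have h₁ := hp₁1 x
    have h₂ := hp₂1 x
    have h₁' : 1 / p₁ x ≤ 1 := (div_le_one (by linarith)).2 h₁
    have h₂' : 1 / p₂ x ≤ 1 := (div_le_one (by linarith)).2 h₂
    rw [hp_eq, one_div]
    exact inv_anti₀ (by positivity) (by linarith)
  have hp_le : ∀ x, p x ≤ p₁ x := by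
    intro x
    have h₁ : 0 < p₁ x := by linarith [hp₁1 x]
    have h₂ : 0 < p₂ x := by linarith [hp₂1 x]
    rw [hp_eq]
    exact inv_le_of_inv_le₀ h₁ (by rw [← one_div]; linarith [one_div_pos.2 h₂])
  have hp_pos : ∀ x, 0 < p x := fun x => by linarith [hp_half x]
  have hwm : Measurable w := by
    rw [funext hw]
    exact hw₁.1.mul hw₂.1
  have hw_pos : ∀ᵐ x ∂(volume : Measure (Rn n)), 0 < w x := by
    filter_upwards [hw₁.2, hw₂.2] with x h₁ h₂
    rw [hw x]
    exact mul_pos h₁ h₂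
  refine ⟨(C + 1) ^ max b 0, ENNReal.rpow_ne_top_of_nonneg (le_max_right _ _)
    (ENNReal.add_ne_top.2 ⟨hC, one_ne_top⟩), fun Q => ?_⟩
  specialize hA Q
  have hM := vNorm_indicator_ne_zero_s14 hpm (by norm_num) hp_half hwm hw_pos Q
  set M := vNorm (ofExp p) (Q.toSet.indicator w)
  set N := vNorm (conjExp p₁) (Q.toSet.indicator fun y => (w₁ y)⁻¹) *
    vNorm (conjExp p₂) (Q.toSet.indicator fun y => (w₂ y)⁻¹)
  set K := N * Q.vol⁻¹ ^ 2 with hK_def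
  have hKM : K * M ≤ C := by
    refine le_of_eq_of_le ?_ hA
    simp only [hK_def, N]
    ring
  have hintegrand : ∀ᵐ x ∂(volume : Measure (Rn n)), x ∈ Q.toSet →
      N ^ p x * Q.vol ^ (-(2 * p x)) * ENNReal.ofReal (w x ^ p x) =
        (K * ENNReal.ofReal |Q.toSet.indicator w x|) ^ p x := by
    filter_upwards [hw_pos] with x hx hxQ
    rw [indicator_of_mem hxQ, abs_of_pos hx, ENNReal.mul_rpow_of_nonneg K _ (hp_pos x).le,
      hK_def, ENNReal.mul_rpow_of_nonneg N _ (hp_pos x).le, ENNReal.ofReal_rpow_of_pos hx,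
      ← ENNReal.rpow_natCast, ← ENNReal.rpow_mul, ENNReal.inv_rpow, ENNReal.rpow_neg]
    norm_num
  rw [setLIntegral_congr_fun_ae Q.measurableSet_toSet hintegrand]
  refine (setLIntegral_le_lintegral _ _).trans ?_
  rcases eq_or_ne K 0 with hK₀ | hK₀
  · simp [hK₀, hp_pos]
  refine lintegral_mul_rpow_le_of_mul_eNorm_lt (fun x => (hp_pos x).le) ?_ (le_max_right _ _)
    hK₀ ?_ le_add_self (ENNReal.add_ne_top.2 ⟨hC, one_ne_top⟩)
    (hKM.trans_lt (ENNReal.lt_add_right hC one_ne_zero))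
  · filter_upwards [hb] with x hx
    exact ((hp_le x).trans hx).trans (le_max_left _ _)
  · intro hK
    rw [hK, ENNReal.top_mul hM] at hKM
    exact hC (top_le_iff.1 hKM)
end
end

section
/- Let p₁(·), p₂(·) : ℝⁿ → [1,∞) satisfy 1 < (pⱼ)₋ ≤ (pⱼ)₊ < ∞ and pⱼ(·) ∈ LH with asymptotic values (pⱼ)∞ for j = 1,2, define p(·) by 1/p = 1/p₁ + 1/p₂ and p∞ by 1/p∞ = 1/(p₁)∞ + 1/(p₂)∞, let w₁, w₂ be weights with w = w₁w₂ and (w₁,w₂,w) ∈ A_{p⃗(·)}, and set u(x) = w(x)^{p(x)}, σⱼ(x) = wⱼ(x)^{−pⱼ'(x)}. Then there is a constant C such that for every cube Q with σ₁(Q) ≥ 1, σ₂(Q) ≥ 1, and u(Q) ≥ 1, and every measurable set E ⊂ Q, [σ₁(Q)σ₂(Q)]^{p∞}·u(E) ≤ C·σ₁(Q)^{p∞/(p₁)∞}·σ₂(Q)^{p∞/(p₂)∞}·|Q|^{2p∞}. -/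
open MeasureTheory ENNReal Set

noncomputable section

/-- If `‖g χ_S‖_{r(·)} < lam` and `lam ^ s(x) ≤ c` on `T ⊆ S`, then `∫_T g ^ s ≤ c`. -/
lemma lintegral_rpow_le_of_vNorm_lt {n : ℕ} {r : Rn n → ℝ≥0∞} {s g : Rn n → ℝ} {a b : ℝ}
    (hr : ∀ᵐ x ∂(volume : Measure (Rn n)), r x = ENNReal.ofReal (s x) ∧ a ≤ s x ∧ s x ≤ b)
    (ha : 0 < a) {S T : Set (Rn n)} (hT : MeasurableSet T) (hTS : T ⊆ S)
    {lam c : ℝ≥0∞} (hlt : lam ≠ ∞) (hc : c ≠ ∞) (h : vNorm r (S.indicator g) < lam)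
    (hle : ∀ᵐ x ∂(volume : Measure (Rn n)), x ∈ T → lam ^ s x ≤ c) :
    ∫⁻ x in T, ENNReal.ofReal (g x) ^ s x ≤ c := by
  obtain ⟨l, ⟨hl0, hl1⟩, hll⟩ := sInf_lt_iff.1 h
  have hlam0 : lam ≠ 0 := (bot_le.trans_lt hll).ne'
  have hmod := le_self_add.trans hl1
  have hae : ∀ᵐ x ∂(volume : Measure (Rn n)), x ∈ {x | r x ≠ ∞} := by
    filter_upwards [hr] with x hx
    simp [hx.1]
  rw [Measure.restrict_eq_self_of_ae_mem hae] at hmod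
  calc ∫⁻ x in T, ENNReal.ofReal (g x) ^ s x
      ≤ ∫⁻ x in T, c * (ENNReal.ofReal |S.indicator g x| / l) ^ (r x).toReal := by
        refine setLIntegral_mono_ae' hT ?_
        filter_upwards [hr, hle] with x hx hxc hxT
        have hs : 0 < s x := ha.trans_le hx.2.1
        rw [hx.1, ENNReal.toReal_ofReal hs.le, Set.indicator_of_mem (hTS hxT)]
        calc ENNReal.ofReal (g x) ^ s x
            = lam ^ s x * (ENNReal.ofReal (g x) / lam) ^ s x := by
              rw [← ENNReal.mul_rpow_of_nonneg _ _ hs.le, ENNReal.mul_div_cancel hlam0 hlt]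
          _ ≤ c * (ENNReal.ofReal |g x| / l) ^ s x := by
              refine mul_le_mul' (hxc hxT) (ENNReal.rpow_le_rpow ?_ hs.le)
              exact ENNReal.div_le_div (ENNReal.ofReal_le_ofReal (le_abs_self _)) hll.le
    _ ≤ ∫⁻ x, c * (ENNReal.ofReal |S.indicator g x| / l) ^ (r x).toReal :=
        setLIntegral_le_lintegral _ _
    _ ≤ c := by
        rw [lintegral_const_mul' _ _ hc]
        exact mul_le_of_le_one_right' hmod

lemma vNorm_indicator_mono {n : ℕ} (r : Rn n → ℝ≥0∞) (g : Rn n → ℝ) {S T : Set (Rn n)}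
    (hST : S ⊆ T) : vNorm r (S.indicator g) ≤ vNorm r (T.indicator g) := by
  have hle : ∀ (l : ℝ≥0∞) (x : Rn n),
      ENNReal.ofReal |S.indicator g x| / l ≤ ENNReal.ofReal |T.indicator g x| / l := by
    intro l x
    refine ENNReal.div_le_div_right (ENNReal.ofReal_le_ofReal ?_) _
    by_cases hx : x ∈ S
    · rw [Set.indicator_of_mem hx, Set.indicator_of_mem (hST hx)]
    · simp [Set.indicator_of_notMem hx]
  refine sInf_le_sInf fun l hl => ⟨hl.1, le_trans (add_le_add ?_ ?_) hl.2⟩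
  · exact lintegral_mono fun x => ENNReal.rpow_le_rpow (hle l x) ENNReal.toReal_nonneg
  · exact essSup_mono_ae (Filter.Eventually.of_forall (hle l))

lemma vNorm_indicator_ne_zero_s15 {n : ℕ} {r : Rn n → ℝ≥0∞} {s g : Rn n → ℝ} {a b : ℝ}
    (hr : ∀ᵐ x ∂(volume : Measure (Rn n)), r x = ENNReal.ofReal (s x) ∧ a ≤ s x ∧ s x ≤ b)
    (ha : 0 < a) (hs : Measurable s) (hg : Measurable g)
    (hg0 : ∀ᵐ x ∂(volume : Measure (Rn n)), 0 < g x) {S : Set (Rn n)} (hS : MeasurableSet S)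
    (hS0 : volume S ≠ 0) : vNorm r (S.indicator g) ≠ 0 := by
  intro h0
  have hbound : ∀ ε : ℝ≥0∞, 0 < ε → ∫⁻ x in S, ENNReal.ofReal (g x) ^ s x ≤ ε := by
    intro ε hε
    set m : ℝ≥0∞ := min ε 1 with hm
    have hm0 : 0 < m := lt_min hε one_pos
    have hm1 : m ≤ 1 := min_le_right _ _
    have hma : (m ^ a⁻¹) ≤ 1 := ENNReal.rpow_le_one hm1 (inv_nonneg.2 ha.le)
    have hmt : m ≠ ∞ := (hm1.trans_lt ENNReal.one_lt_top).ne
    refine le_trans ?_ (min_le_left ε 1)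
    refine lintegral_rpow_le_of_vNorm_lt hr ha hS subset_rfl (lam := m ^ a⁻¹)
      (hma.trans_lt ENNReal.one_lt_top).ne hmt ?_ ?_
    · rw [h0]; exact ENNReal.rpow_pos hm0 hmt
    · filter_upwards [hr] with x hx _
      calc (m ^ a⁻¹) ^ s x ≤ (m ^ a⁻¹) ^ a := ENNReal.rpow_le_rpow_of_exponent_ge hma hx.2.1
        _ = m := ENNReal.rpow_inv_rpow ha.ne' m
  have hz : ∫⁻ x in S, ENNReal.ofReal (g x) ^ s x = 0 :=
    le_antisymm (le_of_forall_gt_imp_ge_of_dense fun ε hε => hbound ε hε) bot_le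
  rw [setLIntegral_eq_zero_iff hS (by fun_prop)] at hz
  refine hS0 (measure_eq_zero_iff_ae_notMem.2 ?_)
  filter_upwards [hz, hg0] with x hx hx0 hxS
  exact (ENNReal.rpow_pos (ENNReal.ofReal_pos.2 hx0) ENNReal.ofReal_ne_top).ne' (hx hxS)

/-- Under log-Hölder decay `1/s(x) → t` and polynomial growth of `g ^ s`, the norm of `g χ_S`
dominates `(∫_S g ^ s) ^ t` whenever `∫_S g ^ s ≥ 1`. -/
lemma exists_lintegral_rpow_le_mul_vNorm {n : ℕ} {r : Rn n → ℝ≥0∞} {s g : Rn n → ℝ}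
    {a b t D A K : ℝ}
    (hr : ∀ᵐ x ∂(volume : Measure (Rn n)), r x = ENNReal.ofReal (s x) ∧ a ≤ s x ∧ s x ≤ b)
    (ha : 0 < a) (hD : 0 ≤ D)
    (ht : ∀ x, |1 / s x - t| ≤ D / Real.log (Real.exp 1 + ‖x‖))
    (hA : 1 ≤ A) (hK : 0 < K)
    (hgrowth : ∀ R : ℝ, 1 ≤ R →
      ∫⁻ x in Metric.ball 0 R, ENNReal.ofReal (g x) ^ s x ≤ ENNReal.ofReal (A * R ^ K)) :
    ∃ C : ℝ≥0∞, C ≠ ∞ ∧ ∀ S : Set (Rn n), MeasurableSet S →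
      1 ≤ ∫⁻ x in S, ENNReal.ofReal (g x) ^ s x →
      ∫⁻ x in S, ENNReal.ofReal (g x) ^ s x ≠ ∞ →
      (∫⁻ x in S, ENNReal.ofReal (g x) ^ s x) ^ t ≤ C * vNorm r (S.indicator g) := by
  set b' : ℝ := max b 1
  have hb' : 0 < b' := lt_max_of_lt_right one_pos
  have hlogA : 0 ≤ Real.log (2 * A) := Real.log_nonneg (by linarith)
  set J : ℝ := b' * D * (Real.log (2 * A) + K) with hJ
  have hJ0 : 0 ≤ J := by positivity
  set M : ℝ := Real.exp J with hM
  have hM1 : 1 ≤ M := Real.one_le_exp hJ0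
  set δ : ℝ := (1 / (4 * M)) ^ a⁻¹ with hδ
  have hδ0 : 0 < δ := by positivity
  have hδ1 : δ ≤ 1 := Real.rpow_le_one (by positivity)
    (by rw [div_le_one (by positivity)]; linarith) (by positivity)
  have hδa : δ ^ a = 1 / (4 * M) := Real.rpow_inv_rpow (by positivity) ha.ne'
  refine ⟨ENNReal.ofReal δ⁻¹, ENNReal.ofReal_ne_top, fun S hS h1 hfin => ?_⟩
  set I : ℝ≥0∞ := ∫⁻ x in S, ENNReal.ofReal (g x) ^ s x with hI
  obtain ⟨V, hV⟩ : ∃ V : ℝ, V = I.toReal := ⟨_, rfl⟩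
  have hIV : I = ENNReal.ofReal V := by rw [hV, ENNReal.ofReal_toReal hfin]
  have hV1 : 1 ≤ V := by
    rw [hIV] at h1
    exact ENNReal.one_le_ofReal.1 h1
  have hV0 : 0 < V := by linarith
  by_contra hcon
  rw [not_le] at hcon
  have hlt : vNorm r (S.indicator g) < ENNReal.ofReal (δ * V ^ t) := by
    rw [ENNReal.ofReal_mul hδ0.le, ← ENNReal.ofReal_rpow_of_pos hV0, ← hIV]
    have h2 := ENNReal.mul_lt_mul_right (a := ENNReal.ofReal δ)
      (by simpa using hδ0) ENNReal.ofReal_ne_top hcon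
    rwa [← mul_assoc, ← ENNReal.ofReal_mul hδ0.le, mul_inv_cancel₀ hδ0.ne',
      ENNReal.ofReal_one, one_mul] at h2
  set B : Set (Rn n) := {x | 2 * A * (Real.exp 1 + ‖x‖) ^ K < V} with hB
  have hBm : MeasurableSet B := measurableSet_lt (by fun_prop) measurable_const
  have hL : ∀ x : Rn n, 1 ≤ Real.log (Real.exp 1 + ‖x‖) := fun x => by
    rw [Real.le_log_iff_exp_le (by positivity)]
    linarith [norm_nonneg x]
  have hbad : ∫⁻ x in S ∩ B, ENNReal.ofReal (g x) ^ s x ≤ ENNReal.ofReal (V / 2) := by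
    by_cases hVA : 2 * A ≤ V
    · set R : ℝ := (V / (2 * A)) ^ K⁻¹ with hR
      have hq : 1 ≤ V / (2 * A) := (one_le_div (by linarith)).2 hVA
      have hR1 : 1 ≤ R := Real.one_le_rpow hq (by positivity)
      have hRK : R ^ K = V / (2 * A) := Real.rpow_inv_rpow (by positivity) hK.ne'
      have hsub : S ∩ B ⊆ Metric.ball 0 R := by
        rintro x ⟨-, hx⟩
        rw [mem_ball_zero_iff]
        have hx' : (Real.exp 1 + ‖x‖) ^ K < R ^ K := by
          rw [hRK, lt_div_iff₀ (by linarith)]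
          have : 2 * A * (Real.exp 1 + ‖x‖) ^ K < V := hx
          linarith
        have := (Real.rpow_lt_rpow_iff (by positivity) (by positivity) hK).1 hx'
        linarith [Real.exp_pos 1]
      refine (lintegral_mono_set hsub).trans ((hgrowth R hR1).trans_eq ?_)
      rw [hRK]
      congr 1
      field_simp
    · have : S ∩ B = ∅ := by
        refine Set.eq_empty_of_forall_notMem fun x hx => hVA ?_
        have h2 : 2 * A * (Real.exp 1 + ‖x‖) ^ K < V := hx.2
        have h3 : 1 ≤ (Real.exp 1 + ‖x‖) ^ K :=
          Real.one_le_rpow (by linarith [Real.one_le_exp zero_le_one, norm_nonneg x]) hK.le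
        nlinarith
      simp [this]
  have hgood : ∫⁻ x in S \ B, ENNReal.ofReal (g x) ^ s x ≤ ENNReal.ofReal (V / 4) := by
    refine lintegral_rpow_le_of_vNorm_lt hr ha (hS.diff hBm) Set.sdiff_subset
      ENNReal.ofReal_ne_top ENNReal.ofReal_ne_top hlt ?_
    filter_upwards [hr] with x hx hxG
    have hs0 : 0 < s x := ha.trans_le hx.2.1
    rw [ENNReal.ofReal_rpow_of_pos (by positivity)]
    refine ENNReal.ofReal_le_ofReal ?_
    have hxV : V ≤ 2 * A * (Real.exp 1 + ‖x‖) ^ K := not_lt.1 hxG.2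
    set L := Real.log (Real.exp 1 + ‖x‖) with hLdef
    have hL1 : 1 ≤ L := hL x
    have hlogV : Real.log V ≤ (Real.log (2 * A) + K) * L := by
      calc Real.log V ≤ Real.log (2 * A * (Real.exp 1 + ‖x‖) ^ K) := Real.log_le_log hV0 hxV
        _ = Real.log (2 * A) + K * L := by
          rw [Real.log_mul (by positivity) (by positivity), Real.log_rpow (by positivity)]
        _ ≤ _ := by nlinarith
    have hexp : t * s x - 1 ≤ b' * (D / L) := by
      have h2 : t * s x - 1 = s x * (t - 1 / s x) := by field_simp
      have h3 : t - 1 / s x ≤ D / L := by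
        have := neg_abs_le (1 / s x - t)
        linarith [ht x]
      rw [h2]
      calc s x * (t - 1 / s x) ≤ s x * (D / L) := mul_le_mul_of_nonneg_left h3 hs0.le
        _ ≤ b' * (D / L) := mul_le_mul_of_nonneg_right (hx.2.2.trans (le_max_left _ _))
          (by positivity)
    have hVpow : V ^ (t * s x - 1) ≤ M := by
      rw [Real.rpow_def_of_pos hV0, hM]
      refine Real.exp_le_exp.2 ?_
      calc Real.log V * (t * s x - 1) ≤ Real.log V * (b' * (D / L)) :=
            mul_le_mul_of_nonneg_left hexp (Real.log_nonneg hV1)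
        _ ≤ ((Real.log (2 * A) + K) * L) * (b' * (D / L)) :=
            mul_le_mul_of_nonneg_right hlogV (by positivity)
        _ = J := by rw [hJ]; field_simp
    calc (δ * V ^ t) ^ s x = δ ^ s x * (V * V ^ (t * s x - 1)) := by
          rw [Real.mul_rpow hδ0.le (by positivity), ← Real.rpow_mul hV0.le,
            Real.rpow_sub_one hV0.ne', mul_div_cancel₀ _ hV0.ne']
      _ ≤ δ ^ a * (V * M) := by
          refine mul_le_mul (Real.rpow_le_rpow_of_exponent_ge hδ0 hδ1 hx.2.1) ?_
            (by positivity) (by positivity)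
          exact mul_le_mul_of_nonneg_left hVpow hV0.le
      _ = V / 4 := by rw [hδa]; field_simp
  have hsum : I ≤ ENNReal.ofReal (V / 2) + ENNReal.ofReal (V / 4) := by
    rw [hI, ← lintegral_inter_add_sdiff _ S hBm]
    exact add_le_add hbad hgood
  rw [hIV, ← ENNReal.ofReal_add (by positivity) (by positivity),
    ENNReal.ofReal_le_ofReal_iff (by positivity)] at hsum
  linarith

namespace Cube

/-- The cube `[-R, R)ⁿ`. -/
def centered (n : ℕ) (R : ℝ) (hR : 1 ≤ R) : Cube n := ⟨fun _ => -R, 2 * R, by linarith⟩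

lemma ball_subset_centered {n : ℕ} {R : ℝ} (hR : 1 ≤ R) :
    Metric.ball (0 : Rn n) R ⊆ (centered n R hR).toSet := by
  intro x hx i
  rw [mem_ball_zero_iff] at hx
  have h := abs_lt.1 ((norm_le_pi_norm x i).trans_lt hx)
  simp only [centered]
  constructor <;> linarith [h.1, h.2]

lemma exists_subset_ball {n : ℕ} (Q : Cube n) : ∃ R : ℝ, 1 ≤ R ∧ Q.toSet ⊆ Metric.ball 0 R := by
  refine ⟨‖Q.base‖ + Q.side + 1, by linarith [norm_nonneg Q.base, Q.side_pos], fun x hx => ?_⟩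
  rw [mem_ball_zero_iff]
  refine lt_of_le_of_lt ((pi_norm_le_iff_of_nonneg
    (add_nonneg (norm_nonneg Q.base) Q.side_pos.le)).2 fun i => ?_) (lt_add_one _)
  have h1 := hx i
  have h2 := abs_le.1 (norm_le_pi_norm Q.base i)
  rw [Real.norm_eq_abs, abs_le]
  constructor <;> linarith [h1.1, h1.2, h2.1, h2.2, Q.side_pos]

lemma vol_ne_top {n : ℕ} (Q : Cube n) : Q.vol ≠ ∞ := ENNReal.ofReal_ne_top

lemma vol_ne_zero {n : ℕ} (Q : Cube n) : Q.vol ≠ 0 :=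
  (ENNReal.ofReal_pos.2 (pow_pos Q.side_pos n)).ne'

end Cube

/-- A norm of polynomial growth on centered cubes forces polynomial growth of `g ^ s`. -/
lemma exists_growth_of_vNorm_le {n : ℕ} {r : Rn n → ℝ≥0∞} {s g : Rn n → ℝ} {a b : ℝ}
    (hr : ∀ᵐ x ∂(volume : Measure (Rn n)), r x = ENNReal.ofReal (s x) ∧ a ≤ s x ∧ s x ≤ b)
    (ha : 0 < a) {B : ℝ≥0∞} (hB : B ≠ ∞)
    (h : ∀ (R : ℝ) (hR : 1 ≤ R), vNorm r ((Cube.centered n R hR).toSet.indicator g) ≤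
      B * (Cube.centered n R hR).vol ^ 2) :
    ∃ A K : ℝ, 1 ≤ A ∧ 0 < K ∧ ∀ R : ℝ, 1 ≤ R →
      ∫⁻ x in Metric.ball 0 R, ENNReal.ofReal (g x) ^ s x ≤ ENNReal.ofReal (A * R ^ K) := by
  set b' : ℝ := max b 1
  have hb' : 0 < b' := lt_max_of_lt_right one_pos
  set c : ℝ := B.toReal * (2 ^ n) ^ 2 + 1 with hc
  have hc1 : 1 ≤ c := le_add_of_nonneg_left (by positivity)
  set k : ℝ := ((n * 2 + 1 : ℕ) : ℝ) with hk
  have hk0 : 0 < k := by positivity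
  refine ⟨c ^ b', k * b', Real.one_le_rpow hc1 hb'.le, by positivity, fun R hR => ?_⟩
  have hlam1 : 1 ≤ c * R ^ k := one_le_mul_of_one_le_of_one_le hc1 (Real.one_le_rpow hR hk0.le)
  have hR0 : 0 < R := by linarith
  refine (lintegral_mono_set (Cube.ball_subset_centered hR)).trans ?_
  refine lintegral_rpow_le_of_vNorm_lt hr ha (Cube.measurableSet_toSet _) subset_rfl
    (lam := ENNReal.ofReal (c * R ^ k)) ENNReal.ofReal_ne_top ENNReal.ofReal_ne_top ?_ ?_
  · refine (h R hR).trans_lt ?_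
    rw [← ENNReal.ofReal_toReal hB, Cube.vol, ← ENNReal.ofReal_pow
      (pow_nonneg (Cube.side_pos _).le _), ← ENNReal.ofReal_mul ENNReal.toReal_nonneg]
    refine (ENNReal.ofReal_lt_ofReal_iff (by positivity)).2 ?_
    have h2 : R ^ (n * 2) ≤ R ^ (n * 2 + 1) := pow_le_pow_right₀ hR (Nat.le_succ _)
    have h3 : 0 < R ^ (n * 2 + 1) := by positivity
    rw [hk, Real.rpow_natCast, hc]
    simp only [Cube.centered]
    calc B.toReal * ((2 * R) ^ n) ^ 2 = B.toReal * (2 ^ n) ^ 2 * R ^ (n * 2) := by ring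
      _ ≤ B.toReal * (2 ^ n) ^ 2 * R ^ (n * 2 + 1) :=
          mul_le_mul_of_nonneg_left h2 (by positivity)
      _ < _ := by linarith
  · filter_upwards [hr] with x hx _
    rw [ENNReal.ofReal_rpow_of_pos (by linarith)]
    refine ENNReal.ofReal_le_ofReal ?_
    calc (c * R ^ k) ^ s x ≤ (c * R ^ k) ^ b' :=
          Real.rpow_le_rpow_of_exponent_le hlam1 (hx.2.2.trans (le_max_left _ _))
      _ = c ^ b' * R ^ (k * b') := by
          rw [Real.mul_rpow (by linarith) (by positivity), Real.rpow_mul hR0.le]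

/-- If a product of three norms is at most `C |Q|²` on every cube, the first factor dominates
`(∫_Q g ^ s) ^ t` for cubes with `∫_Q g ^ s ≥ 1`, and these integrals are finite. -/
lemma exists_lintegral_rpow_le_of_mul_vNorm_le {n : ℕ} {r : Rn n → ℝ≥0∞} {s g : Rn n → ℝ}
    {a b t D : ℝ}
    (hr : ∀ᵐ x ∂(volume : Measure (Rn n)), r x = ENNReal.ofReal (s x) ∧ a ≤ s x ∧ s x ≤ b)
    (ha : 0 < a) (hD : 0 ≤ D)
    (ht : ∀ x, |1 / s x - t| ≤ D / Real.log (Real.exp 1 + ‖x‖))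
    {r₂ r₃ : Rn n → ℝ≥0∞} {g₂ g₃ : Rn n → ℝ} {C : ℝ≥0∞} (hC : C ≠ ∞)
    (h₂ : vNorm r₂ ((Cube.centered n 1 le_rfl).toSet.indicator g₂) ≠ 0)
    (h₃ : vNorm r₃ ((Cube.centered n 1 le_rfl).toSet.indicator g₃) ≠ 0)
    (h : ∀ Q : Cube n, vNorm r (Q.toSet.indicator g) *
      (vNorm r₂ (Q.toSet.indicator g₂) * vNorm r₃ (Q.toSet.indicator g₃)) ≤ C * Q.vol ^ 2) :
    ∃ C' : ℝ≥0∞, C' ≠ ∞ ∧ ∀ Q : Cube n,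
      ∫⁻ x in Q.toSet, ENNReal.ofReal (g x) ^ s x ≠ ∞ ∧
      (1 ≤ ∫⁻ x in Q.toSet, ENNReal.ofReal (g x) ^ s x →
        (∫⁻ x in Q.toSet, ENNReal.ofReal (g x) ^ s x) ^ t ≤
          C' * vNorm r (Q.toSet.indicator g)) := by
  set N := vNorm r₂ ((Cube.centered n 1 le_rfl).toSet.indicator g₂) *
    vNorm r₃ ((Cube.centered n 1 le_rfl).toSet.indicator g₃) with hN
  have hN0 : N ≠ 0 := mul_ne_zero h₂ h₃
  obtain ⟨A, K, hA, hK, hgrowth⟩ := exists_growth_of_vNorm_le (g := g) hr ha (B := C / N)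
    (ENNReal.div_ne_top hC hN0) (by
      intro R hR
      set Q := Cube.centered n R hR
      have hsub : (Cube.centered n 1 le_rfl).toSet ⊆ Q.toSet := by
        intro x hx i
        have := hx i
        simp only [Q, Cube.centered] at this ⊢
        constructor <;> linarith [this.1, this.2]
      have hX : C * Q.vol ^ 2 ≠ ∞ := ENNReal.mul_ne_top hC (ENNReal.pow_ne_top Q.vol_ne_top)
      have hle : vNorm r (Q.toSet.indicator g) * N ≤ C * Q.vol ^ 2 :=
        le_trans (mul_le_mul_right (mul_le_mul' (vNorm_indicator_mono _ _ hsub)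
          (vNorm_indicator_mono _ _ hsub)) _) (h Q)
      rw [← ENNReal.mul_div_right_comm]
      exact (ENNReal.le_div_iff_mul_le (Or.inl hN0) (Or.inr hX)).2 hle)
  obtain ⟨C', hC', hmain⟩ := exists_lintegral_rpow_le_mul_vNorm hr ha hD ht hA hK hgrowth
  refine ⟨C', hC', fun Q => ?_⟩
  have hfin : ∫⁻ x in Q.toSet, ENNReal.ofReal (g x) ^ s x ≠ ∞ := by
    obtain ⟨R, hR, hsub⟩ := Q.exists_subset_ball
    exact (((lintegral_mono_set hsub).trans (hgrowth R hR)).trans_lt ENNReal.ofReal_lt_top).ne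
  exact ⟨hfin, fun h1 => hmain _ Q.measurableSet_toSet h1 hfin⟩

lemma ae_conjExp_eq {n : ℕ} {p : Rn n → ℝ} {a b : ℝ} (ha : 1 < a)
    (hp : ∀ᵐ x ∂(volume : Measure (Rn n)), a ≤ p x ∧ p x ≤ b) :
    ∀ᵐ x ∂(volume : Measure (Rn n)), conjExp p x = ENNReal.ofReal (p x / (p x - 1)) ∧
      1 ≤ p x / (p x - 1) ∧ p x / (p x - 1) ≤ a / (a - 1) := by
  filter_upwards [hp] with x hx
  have h1 : 1 < p x := ha.trans_le hx.1
  refine ⟨?_, ?_, ?_⟩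
  · have hne : ENNReal.ofReal (p x) ≠ 1 := by
      rw [Ne, ENNReal.ofReal_eq_one]; exact h1.ne'
    rw [conjExp, econj, if_neg hne, if_neg ENNReal.ofReal_ne_top,
      ENNReal.toReal_ofReal (by linarith)]
  · rw [one_le_div (by linarith)]; linarith
  · rw [div_le_div_iff₀ (by linarith) (by linarith)]; nlinarith [hx.1]

lemma abs_one_div_conj_sub {q q' : ℝ} (hq : 1 ≤ q) :
    |1 / (q / (q - 1)) - (1 - 1 / q')| = |1 / q - 1 / q'| := by
  have : 1 / (q / (q - 1)) = 1 - 1 / q := by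
    rw [one_div_div, sub_div, div_self (by linarith)]
  rw [this, abs_sub_comm]
  congr 1
  ring

lemma setLIntegral_ofReal_rpow_neg {n : ℕ} {w s σ : Rn n → ℝ} (hw : IsWeight w)
    (hσ : ∀ x, σ x = w x ^ (-s x)) (S : Set (Rn n)) :
    ∫⁻ x in S, ENNReal.ofReal (σ x) = ∫⁻ x in S, ENNReal.ofReal (w x)⁻¹ ^ s x := by
  refine lintegral_congr_ae (ae_restrict_of_ae ?_)
  filter_upwards [hw.2] with x hx
  rw [ENNReal.ofReal_rpow_of_pos (inv_pos.2 hx), hσ, Real.inv_rpow hx.le, Real.rpow_neg hx.le]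

/-- Raising a three-factor product estimate to the power `q` and completing the powers. -/
lemma ENNReal.mul_rpow_mul_le_of_rpow_mul_le {X Y U C V : ℝ≥0∞} {q c d : ℝ} (hq : 0 < q)
    (hX0 : X ≠ 0) (hX : X ≠ ∞) (hY0 : Y ≠ 0) (hY : Y ≠ ∞)
    (h : U ^ (1 / q) * (X ^ (1 - c) * Y ^ (1 - d)) ≤ C * V ^ 2) :
    (X * Y) ^ q * U ≤ C ^ q * X ^ (q * c) * Y ^ (q * d) * V ^ (2 * q) := by
  have h2 := ENNReal.rpow_le_rpow h hq.le
  rw [ENNReal.mul_rpow_of_nonneg _ _ hq.le, ENNReal.mul_rpow_of_nonneg _ _ hq.le,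
    ENNReal.mul_rpow_of_nonneg _ _ hq.le, ← ENNReal.rpow_mul, ← ENNReal.rpow_mul,
    ← ENNReal.rpow_mul, one_div_mul_cancel hq.ne', ENNReal.rpow_one, ← ENNReal.rpow_natCast,
    ← ENNReal.rpow_mul] at h2
  have hXq : X ^ q = X ^ ((1 - c) * q) * X ^ (q * c) := by
    rw [← ENNReal.rpow_add _ _ hX0 hX]; congr 1; ring
  have hYq : Y ^ q = Y ^ ((1 - d) * q) * Y ^ (q * d) := by
    rw [← ENNReal.rpow_add _ _ hY0 hY]; congr 1; ring
  calc (X * Y) ^ q * U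
      = U * (X ^ ((1 - c) * q) * Y ^ ((1 - d) * q)) * (X ^ (q * c) * Y ^ (q * d)) := by
        rw [ENNReal.mul_rpow_of_nonneg _ _ hq.le, hXq, hYq]; ring
    _ ≤ C ^ q * V ^ (((2 : ℕ) : ℝ) * q) * (X ^ (q * c) * Y ^ (q * d)) := by gcongr
    _ = _ := by push_cast; ring

/-- the estimate
`[σ₁(Q)σ₂(Q)]^{p∞} u(E) ≲ σ₁(Q)^{p∞/(p₁)∞} σ₂(Q)^{p∞/(p₂)∞} |Q|^{2p∞}`
for cubes `Q` with `σ₁(Q), σ₂(Q), u(Q) ≥ 1` and `E ⊂ Q`. -/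
theorem statement15 {n : ℕ} (p₁ p₂ p w₁ w₂ w u σ₁ σ₂ : Rn n → ℝ)
    (p₁inf p₂inf pinf : ℝ)
    (hp₁m : Measurable p₁) (hp₂m : Measurable p₂)
    (hp₁1 : ∀ x, 1 ≤ p₁ x) (hp₂1 : ∀ x, 1 ≤ p₂ x)
    (hp₁b : ∃ a b : ℝ, 1 < a ∧ ∀ᵐ x ∂(volume : Measure (Rn n)), a ≤ p₁ x ∧ p₁ x ≤ b)
    (hp₂b : ∃ a b : ℝ, 1 < a ∧ ∀ᵐ x ∂(volume : Measure (Rn n)), a ≤ p₂ x ∧ p₂ x ≤ b)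
    (hp₁inf : 0 < p₁inf) (hp₂inf : 0 < p₂inf)
    (hp₁LH : LH0 p₁ ∧ LHinfWith p₁ p₁inf)
    (hp₂LH : LH0 p₂ ∧ LHinfWith p₂ p₂inf)
    (hp : ∀ x, 1 / p x = 1 / p₁ x + 1 / p₂ x)
    (hpinf : 1 / pinf = 1 / p₁inf + 1 / p₂inf)
    (hw₁ : IsWeight w₁) (hw₂ : IsWeight w₂)
    (hw : ∀ x, w x = w₁ x * w₂ x)
    (hA : ApVec p₁ p₂ p w₁ w₂ w)
    (hu : ∀ x, u x = w x ^ p x)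
    (hσ₁ : ∀ x, σ₁ x = w₁ x ^ (-(p₁ x / (p₁ x - 1))))
    (hσ₂ : ∀ x, σ₂ x = w₂ x ^ (-(p₂ x / (p₂ x - 1)))) :
    ∃ C : ℝ≥0∞, C ≠ ∞ ∧ ∀ (Q : Cube n) (E : Set (Rn n)), MeasurableSet E → E ⊆ Q.toSet →
      1 ≤ (∫⁻ y in Q.toSet, ENNReal.ofReal (σ₁ y)) →
      1 ≤ (∫⁻ y in Q.toSet, ENNReal.ofReal (σ₂ y)) →
      1 ≤ (∫⁻ y in Q.toSet, ENNReal.ofReal (u y)) →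
      ((∫⁻ y in Q.toSet, ENNReal.ofReal (σ₁ y)) *
            (∫⁻ y in Q.toSet, ENNReal.ofReal (σ₂ y))) ^ pinf *
          (∫⁻ y in E, ENNReal.ofReal (u y)) ≤
        C * (∫⁻ y in Q.toSet, ENNReal.ofReal (σ₁ y)) ^ (pinf / p₁inf) *
          (∫⁻ y in Q.toSet, ENNReal.ofReal (σ₂ y)) ^ (pinf / p₂inf) *
            Q.vol ^ (2 * pinf) := by
  obtain ⟨a₁, b₁, ha₁, hb₁⟩ := hp₁b
  obtain ⟨a₂, b₂, ha₂, hb₂⟩ := hp₂b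
  obtain ⟨-, D₁, hD₁, hL₁⟩ := hp₁LH
  obtain ⟨-, D₂, hD₂, hL₂⟩ := hp₂LH
  obtain ⟨C, hC, hAp⟩ := hA
  have hpm : Measurable p := by
    have : p = fun x => 1 / (1 / p₁ x + 1 / p₂ x) := by
      funext x; rw [← hp, one_div_one_div]
    rw [this]
    fun_prop
  have hwm : Measurable w := by
    rw [funext hw]; exact hw₁.1.mul hw₂.1
  have hw0 : ∀ᵐ x ∂(volume : Measure (Rn n)), 0 < w x := by
    filter_upwards [hw₁.2, hw₂.2] with x h1 h2
    rw [hw]; exact mul_pos h1 h2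
  have hi₁ : ∀ᵐ x ∂(volume : Measure (Rn n)), 0 < (w₁ x)⁻¹ := by
    filter_upwards [hw₁.2] with x h using inv_pos.2 h
  have hi₂ : ∀ᵐ x ∂(volume : Measure (Rn n)), 0 < (w₂ x)⁻¹ := by
    filter_upwards [hw₂.2] with x h using inv_pos.2 h
  have hrp : ∀ᵐ x ∂(volume : Measure (Rn n)),
      ofExp p x = ENNReal.ofReal (p x) ∧ 1 / 2 ≤ p x ∧ p x ≤ b₁ := by
    filter_upwards [hb₁] with x hx
    have e1 : 0 < p₁ x := by linarith [hp₁1 x]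
    have e2 : 0 < p₂ x := by linarith [hp₂1 x]
    have f1 : 1 / p₁ x ≤ 1 := (div_le_one e1).2 (hp₁1 x)
    have f2 : 1 / p₂ x ≤ 1 := (div_le_one e2).2 (hp₂1 x)
    have e3 : 0 < 1 / p x := by rw [hp]; positivity
    have e4 : 0 < p x := one_div_pos.1 e3
    refine ⟨rfl, ?_, le_trans ?_ hx.2⟩
    · rw [div_le_iff₀ two_pos, ← div_le_iff₀' e4, hp]; linarith
    · rw [← one_div_le_one_div e1 e4, hp]
      exact le_add_of_nonneg_right (by positivity)
  have hr₁ := ae_conjExp_eq ha₁ hb₁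
  have hr₂ := ae_conjExp_eq ha₂ hb₂
  have hLp : ∀ x, |1 / p x - 1 / pinf| ≤ (D₁ + D₂) / Real.log (Real.exp 1 + ‖x‖) := by
    intro x
    rw [hp, hpinf, add_div]
    calc |1 / p₁ x + 1 / p₂ x - (1 / p₁inf + 1 / p₂inf)|
        = |(1 / p₁ x - 1 / p₁inf) + (1 / p₂ x - 1 / p₂inf)| := by congr 1; ring
      _ ≤ _ := (abs_add_le _ _).trans (add_le_add (hL₁ x) (hL₂ x))
  have hq : 0 < pinf := one_div_pos.1 (by rw [hpinf]; positivity)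
  set Q₁ : Cube n := Cube.centered n 1 le_rfl
  have hQ0 : volume Q₁.toSet ≠ 0 :=
    ((Metric.isOpen_ball.measure_pos volume ⟨0, Metric.mem_ball_self one_pos⟩).trans_le
      (measure_mono (Cube.ball_subset_centered le_rfl))).ne'
  have hQm : MeasurableSet Q₁.toSet := Cube.measurableSet_toSet _
  have hn := vNorm_indicator_ne_zero_s15 hrp (by norm_num) hpm hwm hw0 hQm hQ0
  have hn₁ := vNorm_indicator_ne_zero_s15 hr₁ one_pos (by fun_prop) hw₁.1.inv hi₁ hQm hQ0
  have hn₂ := vNorm_indicator_ne_zero_s15 hr₂ one_pos (by fun_prop) hw₂.1.inv hi₂ hQm hQ0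
  have hprod : ∀ Q : Cube n, vNorm (ofExp p) (Q.toSet.indicator w) *
      (vNorm (conjExp p₁) (Q.toSet.indicator fun x => (w₁ x)⁻¹) *
        vNorm (conjExp p₂) (Q.toSet.indicator fun x => (w₂ x)⁻¹)) ≤ C * Q.vol ^ 2 := by
    intro Q
    have h := hAp Q
    rw [mul_assoc, mul_assoc, ← ENNReal.inv_pow, mul_comm, ← div_eq_mul_inv,
      ENNReal.div_le_iff (pow_ne_zero 2 Q.vol_ne_zero) (ENNReal.pow_ne_top Q.vol_ne_top)] at h
    exact h
  obtain ⟨K₀, hK₀, hm₀⟩ := exists_lintegral_rpow_le_of_mul_vNorm_le hrp (by norm_num)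
    (by positivity) hLp hC hn₁ hn₂ hprod
  obtain ⟨K₁, hK₁, hm₁⟩ := exists_lintegral_rpow_le_of_mul_vNorm_le hr₁ one_pos hD₁.le
    (fun x => (abs_one_div_conj_sub (q' := p₁inf) (hp₁1 x)).trans_le (hL₁ x)) hC hn hn₂
    (fun Q => (mul_left_comm _ _ _).trans_le (hprod Q))
  obtain ⟨K₂, hK₂, hm₂⟩ := exists_lintegral_rpow_le_of_mul_vNorm_le hr₂ one_pos hD₂.le
    (fun x => (abs_one_div_conj_sub (q' := p₂inf) (hp₂1 x)).trans_le (hL₂ x)) hC hn hn₁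
    (fun Q => ((mul_left_comm _ _ _).trans
      (congrArg _ (mul_comm _ _))).trans_le (hprod Q))
  refine ⟨(K₀ * (K₁ * K₂) * C) ^ pinf, ENNReal.rpow_ne_top_of_nonneg hq.le
    (by finiteness), fun Q E _ hEQ h1 h2 h0 => ?_⟩
  have hu' : ∫⁻ y in Q.toSet, ENNReal.ofReal (u y) =
      ∫⁻ y in Q.toSet, ENNReal.ofReal (w y) ^ p y := by
    refine lintegral_congr_ae (ae_restrict_of_ae ?_)
    filter_upwards [hw0] with x hx
    rw [hu, ENNReal.ofReal_rpow_of_pos hx]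
  have hσ₁' := setLIntegral_ofReal_rpow_neg hw₁ hσ₁ Q.toSet
  have hσ₂' := setLIntegral_ofReal_rpow_neg hw₂ hσ₂ Q.toSet
  have g0 := (hm₀ Q).2
  obtain ⟨f1, g1⟩ := hm₁ Q
  obtain ⟨f2, g2⟩ := hm₂ Q
  rw [← hu'] at g0
  rw [← hσ₁'] at f1 g1
  rw [← hσ₂'] at f2 g2
  rw [div_eq_mul_one_div pinf p₁inf, div_eq_mul_one_div pinf p₂inf]
  refine le_trans (mul_le_mul_right (lintegral_mono_set hEQ) _)
    (ENNReal.mul_rpow_mul_le_of_rpow_mul_le hq (one_pos.trans_le h1).ne' f1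
      (one_pos.trans_le h2).ne' f2 ?_)
  refine (mul_le_mul' (g0 h0) (mul_le_mul' (g1 h1) (g2 h2))).trans ?_
  calc _ = K₀ * (K₁ * K₂) * (vNorm (ofExp p) (Q.toSet.indicator w) *
      (vNorm (conjExp p₁) (Q.toSet.indicator fun x => (w₁ x)⁻¹) *
        vNorm (conjExp p₂) (Q.toSet.indicator fun x => (w₂ x)⁻¹))) := by ring
    _ ≤ K₀ * (K₁ * K₂) * (C * Q.vol ^ 2) := mul_le_mul_right (hprod Q) _
    _ = _ := by ring
end
end
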